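/- Let n = 3 and suppose f is a transcendental entire function of finite order on ℂ solving the differential-difference equation f(z)^n + w·f(z)^{n-1}·f'(z) + f^{(k)}(z+c) = p₁e^{α₁z} + p₂e^{α₂z}, and additionally N(r,1/f) = S(r,f). Then f has the form f(z) = C·e^{az}, where a and C are nonzero complex constants satisfying a = α_i and n·a = α_j for some indices {i,j} = {1,2}, with 1 + a·w ≠ 0 and C^n·(1 + a·w) = p_j. -/

import Mathlib

open MeasureTheory Filter Metric

noncomputable section

/-- The positive part `log⁺` of the logarithm. -/
def logPlus (x : ℝ) : ℝ := max (Real.log x) 0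

/-- The Nevanlinna proximity function `m(r,f)`.  For an entire function `f` (which has no
poles) this coincides with the Nevanlinna characteristic `T(r,f)`. -/
def nevCharEntire (f : ℂ → ℂ) (r : ℝ) : ℝ :=
  (2 * Real.pi)⁻¹ * ∫ θ in (0:ℝ)..(2 * Real.pi), logPlus ‖f (r * Complex.exp (θ * Complex.I))‖

/-- The order of growth `ρ(f) = limsup_{r→∞} log⁺ T(r,f) / log r` of an entire function,
as an extended real number. -/
def growthOrderEntire (f : ℂ → ℂ) : EReal :=
  Filter.limsup (fun r : ℝ => ((logPlus (nevCharEntire f r) / Real.log r : ℝ) : EReal))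
    Filter.atTop

/-- An entire function is transcendental if it is not a polynomial. -/
def TranscendentalEntire (f : ℂ → ℂ) : Prop := ¬ ∃ p : Polynomial ℂ, ∀ z, f z = p.eval z

/-- The multiplicity of `z` as a zero of an entire function `f`: the smallest `k` such that
the `k`-th derivative of `f` does not vanish at `z` (`0` if `f z ≠ 0`). -/
def zeroMult (f : ℂ → ℂ) (z : ℂ) : ℕ := sInf {k : ℕ | iteratedDeriv k f z ≠ 0}

/-- The unintegrated counting function `n(r, 1/f)`: the number of zeros of `f`, counted with
multiplicity, in the closed disc `|z| ≤ r`. -/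
def zeroCount (f : ℂ → ℂ) (r : ℝ) : ℕ := ∑ᶠ z ∈ Metric.closedBall (0:ℂ) r, zeroMult f z

/-- The integrated counting function
`N(r,1/f) = ∫₀^r (n(t,1/f) − n(0,1/f))/t dt + n(0,1/f) log r` of the zeros of `f`. -/
def integZeroCount (f : ℂ → ℂ) (r : ℝ) : ℝ :=
  (zeroCount f 0 : ℝ) * Real.log r +
    ∫ t in (0:ℝ)..r, ((zeroCount f t : ℝ) - (zeroCount f 0 : ℝ)) / t

/-- `SmallFn g T` says that `g(r) = o(T(r))` as `r → ∞` outside a possible exceptional set of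
finite linear (Lebesgue) measure; i.e. `g(r) = S(r,f)` when `T = T(·,f)`. -/
def SmallFn (g T : ℝ → ℝ) : Prop :=
  ∃ E : Set ℝ, volume E < ⊤ ∧
    ∀ ε : ℝ, 0 < ε → ∃ R : ℝ, ∀ r : ℝ, R ≤ r → r ∉ E → |g r| ≤ ε * T r

section ZeroMultiplicity

variable {f : ℂ → ℂ}

lemma analyticOrderAt_ne_top_of_entire (hf : Differentiable ℂ f) (h0 : ∃ z, f z ≠ 0) (a : ℂ) :
    analyticOrderAt f a ≠ ⊤ := by
  obtain ⟨b, hb⟩ := h0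
  have hA : AnalyticOnNhd ℂ f Set.univ := fun z _ => hf.analyticAt z
  refine hA.analyticOrderAt_ne_top_of_isPreconnected isPreconnected_univ
    (Set.mem_univ b) (Set.mem_univ a) ?_
  rw [(hf.analyticAt b).analyticOrderAt_eq_zero.mpr hb]
  exact ENat.zero_ne_top

lemma zeroMult_eq_of_analyticOrderAt (hf : Differentiable ℂ f) {a : ℂ} {m : ℕ}
    (h : analyticOrderAt f a = m) : zeroMult f a = m := by
  have hlt := (natCast_le_analyticOrderAt_iff_iteratedDeriv_eq_zero (hf.analyticAt a)
    (n := m)).mp h.ge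
  have hm : iteratedDeriv m f a ≠ 0 := by
    intro hm
    have : ((m + 1 : ℕ) : ℕ∞) ≤ analyticOrderAt f a := by
      rw [natCast_le_analyticOrderAt_iff_iteratedDeriv_eq_zero (hf.analyticAt a)]
      intro i hi
      rcases Nat.lt_succ_iff_lt_or_eq.mp hi with hi | rfl
      · exact hlt i hi
      · exact hm
    rw [h] at this
    have := ENat.natCast_le_natCast.mp this
    omega
  refine le_antisymm (Nat.sInf_le hm) (le_csInf ⟨m, hm⟩ fun k hk => ?_)
  by_contra! hkm
  exact hk (hlt k hkm)

lemma zeroMult_eq_of_factor {g : ℂ → ℂ} (hf : Differentiable ℂ f) (hg : Differentiable ℂ g)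
    {a : ℂ} {m : ℕ} (hga : g a ≠ 0) (h : ∀ z, f z = (z - a) ^ m * g z) : zeroMult f a = m := by
  refine zeroMult_eq_of_analyticOrderAt hf ?_
  rw [(hf.analyticAt a).analyticOrderAt_eq_natCast]
  exact ⟨g, hg.analyticAt a, hga, Eventually.of_forall fun z => by simpa using h z⟩

lemma exists_factor_zeroMult (hf : Differentiable ℂ f) (h0 : ∃ z, f z ≠ 0) (a : ℂ) :
    ∃ g : ℂ → ℂ, Differentiable ℂ g ∧ g a ≠ 0 ∧ ∀ z, f z = (z - a) ^ zeroMult f a * g z := by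
  have htop := analyticOrderAt_ne_top_of_entire hf h0 a
  obtain ⟨m, hm⟩ := ENat.ne_top_iff_exists.mp htop
  rw [zeroMult_eq_of_analyticOrderAt hf hm.symm]
  obtain ⟨g, hg, hga, hfg⟩ := (hf.analyticAt a).analyticOrderAt_eq_natCast.mp hm.symm
  simp only [smul_eq_mul] at hfg
  refine ⟨Function.update (fun z => f z / (z - a) ^ m) a (g a), ?_, by simpa using hga, ?_⟩
  · intro z
    by_cases hz : z = a
    · subst hz
      refine (hg.differentiableAt).congr_of_eventuallyEq ?_
      filter_upwards [hfg] with x hx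
      by_cases hxz : x = z
      · subst hxz; simp
      · rw [Function.update_of_ne hxz, hx, mul_div_cancel_left₀]
        exact pow_ne_zero _ (sub_ne_zero.mpr hxz)
    · have : DifferentiableAt ℂ (fun z => f z / (z - a) ^ m) z :=
        (hf z).div (by fun_prop) (pow_ne_zero _ (sub_ne_zero.mpr hz))
      refine this.congr_of_eventuallyEq ?_
      filter_upwards [isOpen_ne.mem_nhds hz] with x hx
      rw [Function.update_of_ne hx]
  · intro z
    by_cases hz : z = a
    · subst hz
      simpa using hfg.self_of_nhds
    · rw [Function.update_of_ne hz, mul_div_cancel₀]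
      exact pow_ne_zero _ (sub_ne_zero.mpr hz)

lemma zeroMult_eq_zero_iff (hf : Differentiable ℂ f) (h0 : ∃ z, f z ≠ 0) (a : ℂ) :
    zeroMult f a = 0 ↔ f a ≠ 0 := by
  obtain ⟨g, -, hga, hfg⟩ := exists_factor_zeroMult hf h0 a
  constructor
  · intro h
    rw [hfg a, h]
    simpa using hga
  · intro h
    by_contra h2
    apply h
    rw [hfg a, sub_self, zero_pow h2, zero_mul]

lemma finite_zeros_closedBall (hf : Differentiable ℂ f) (h0 : ∃ z, f z ≠ 0) (R : ℝ) :
    {z | z ∈ closedBall (0 : ℂ) R ∧ f z = 0}.Finite := by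
  by_contra hinf
  obtain ⟨x, -, hx⟩ := Set.Infinite.exists_accPt_of_subset_isCompact (K := closedBall (0 : ℂ) R)
    hinf (isCompact_closedBall _ _) (fun z hz => hz.1)
  have hA : AnalyticOnNhd ℂ f Set.univ := fun z _ => hf.analyticAt z
  have hfr : ∃ᶠ z in nhdsWithin x {x}ᶜ, f z = 0 := by
    rw [accPt_iff_frequently_nhdsNE] at hx
    exact hx.mono fun z hz => hz.2
  have := hA.eqOn_zero_of_preconnected_of_frequently_eq_zero isPreconnected_univ
    (Set.mem_univ x) hfr
  obtain ⟨b, hb⟩ := h0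
  exact hb (this (Set.mem_univ b))

/-- The zeros of `f` in the closed disc of radius `R` about the origin. -/
def zerosIn (f : ℂ → ℂ) (R : ℝ) : Finset ℂ :=
  open Classical in
  if h : {z | z ∈ closedBall (0 : ℂ) R ∧ f z = 0}.Finite then h.toFinset else ∅

lemma mem_zerosIn (hf : Differentiable ℂ f) (h0 : ∃ z, f z ≠ 0) {R : ℝ} {a : ℂ} :
    a ∈ zerosIn f R ↔ ‖a‖ ≤ R ∧ f a = 0 := by
  rw [zerosIn, dif_pos (finite_zeros_closedBall hf h0 R)]
  simp

lemma exists_prod_factor (hf : Differentiable ℂ f) (h0 : ∃ z, f z ≠ 0) (S : Finset ℂ) :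
    ∃ g : ℂ → ℂ, Differentiable ℂ g ∧ (∀ a ∈ S, g a ≠ 0) ∧
      ∀ z, f z = (∏ a ∈ S, (z - a) ^ zeroMult f a) * g z := by
  classical
  induction S using Finset.induction_on with
  | empty => exact ⟨f, hf, by simp, by simp⟩
  | insert b S hb ih =>
    obtain ⟨g, hg, hgS, hfg⟩ := ih
    have hg0 : ∃ z, g z ≠ 0 := by
      obtain ⟨z, hz⟩ := h0
      exact ⟨z, fun h => hz (by rw [hfg, h, mul_zero])⟩
    obtain ⟨g₂, hg₂, hg₂b, hgg⟩ := exists_factor_zeroMult hg hg0 b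
    have hm : zeroMult f b = zeroMult g b := by
      refine zeroMult_eq_of_factor (g := fun z => (∏ a ∈ S, (z - a) ^ zeroMult f a) * g₂ z)
        hf (by fun_prop) ?_ ?_
      · refine mul_ne_zero (Finset.prod_ne_zero_iff.mpr fun a ha => pow_ne_zero _ ?_) hg₂b
        exact sub_ne_zero.mpr fun h => hb (h ▸ ha)
      · intro z
        rw [hfg z, hgg z]
        ring
    refine ⟨g₂, hg₂, ?_, ?_⟩
    · intro a ha
      rcases Finset.mem_insert.mp ha with rfl | ha
      · exact hg₂b
      · intro h
        exact hgS a ha (by rw [hgg, h, mul_zero])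
    · intro z
      rw [Finset.prod_insert hb, hfg z, hgg z, hm]
      ring

lemma exists_factor_zerosIn (hf : Differentiable ℂ f) (h0 : ∃ z, f z ≠ 0) (R : ℝ) :
    ∃ g : ℂ → ℂ, Differentiable ℂ g ∧ (∀ z, ‖z‖ ≤ R → g z ≠ 0) ∧
      ∀ z, f z = (∏ a ∈ zerosIn f R, (z - a) ^ zeroMult f a) * g z := by
  obtain ⟨g, hg, hgS, hfg⟩ := exists_prod_factor hf h0 (zerosIn f R)
  refine ⟨g, hg, fun z hz h => ?_, hfg⟩
  exact hgS z ((mem_zerosIn hf h0).mpr ⟨hz, by rw [hfg, h, mul_zero]⟩) h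

lemma zeroCount_eq_sum_zerosIn (hf : Differentiable ℂ f) (h0 : ∃ z, f z ≠ 0) (R : ℝ) :
    zeroCount f R = ∑ a ∈ zerosIn f R, zeroMult f a := by
  rw [zeroCount, finsum_mem_eq_sum_of_inter_support_eq]
  ext z
  simp only [Set.mem_inter_iff, mem_closedBall, dist_zero_right, Function.mem_support,
    SetLike.mem_coe, mem_zerosIn hf h0, ne_eq, zeroMult_eq_zero_iff hf h0]
  tauto

lemma zerosIn_mono (hf : Differentiable ℂ f) (h0 : ∃ z, f z ≠ 0) {r R : ℝ} (h : r ≤ R) :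
    zerosIn f r ⊆ zerosIn f R := by
  intro a ha
  rw [mem_zerosIn hf h0] at ha ⊢
  exact ⟨ha.1.trans h, ha.2⟩

lemma zeroCount_eq_sum_ite (hf : Differentiable ℂ f) (h0 : ∃ z, f z ≠ 0) {r R : ℝ} (h : r ≤ R) :
    (zeroCount f r : ℝ) = ∑ a ∈ zerosIn f R, if ‖a‖ ≤ r then (zeroMult f a : ℝ) else 0 := by
  rw [zeroCount_eq_sum_zerosIn hf h0, Nat.cast_sum, ← Finset.sum_filter]
  refine Finset.sum_congr ?_ fun _ _ => rfl
  ext a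
  rw [Finset.mem_filter, mem_zerosIn hf h0, mem_zerosIn hf h0]
  constructor
  · rintro ⟨h1, h2⟩; exact ⟨⟨h1.trans h, h2⟩, h1⟩
  · rintro ⟨⟨-, h2⟩, h1⟩; exact ⟨h1, h2⟩

lemma zeroCount_zero (hf : Differentiable ℂ f) (h0 : ∃ z, f z ≠ 0) :
    zeroCount f 0 = zeroMult f 0 := by
  rw [zeroCount_eq_sum_zerosIn hf h0]
  by_cases h : f 0 = 0
  · have : zerosIn f 0 = {0} := by
      ext a
      rw [mem_zerosIn hf h0, norm_le_zero_iff, Finset.mem_singleton]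
      exact ⟨fun h => h.1, fun ha => ⟨ha, ha ▸ h⟩⟩
    simp [this]
  · have : zerosIn f 0 = ∅ := by
      refine Finset.eq_empty_of_forall_notMem fun a ha => ?_
      rw [mem_zerosIn hf h0, norm_le_zero_iff] at ha
      exact h (ha.1 ▸ ha.2)
    rw [this, (zeroMult_eq_zero_iff hf h0 0).mpr h]
    simp

end ZeroMultiplicity

section Jensen

lemma circleAverage_mono_off_countable {f₁ f₂ : ℂ → ℝ} {R : ℝ} (hR : R ≠ 0) {s : Set ℂ}
    (hs : s.Countable) (h₁ : CircleIntegrable f₁ 0 R) (h₂ : CircleIntegrable f₂ 0 R)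
    (h : ∀ z ∈ sphere (0 : ℂ) |R|, z ∉ s → f₁ z ≤ f₂ z) :
    Real.circleAverage f₁ 0 R ≤ Real.circleAverage f₂ 0 R := by
  rw [Real.circleAverage_def, Real.circleAverage_def]
  refine smul_le_smul_of_nonneg_left ?_ (by positivity)
  refine intervalIntegral.integral_mono_ae (by positivity) h₁ h₂ ?_
  filter_upwards [(measure_eq_zero_iff_ae_notMem.mp
    ((hs.preimage_circleMap 0 hR).measure_zero volume))] with θ hθ
  exact h _ (circleMap_mem_sphere' 0 R θ) hθ

lemma circleAverage_congr_off_countable {f₁ f₂ : ℂ → ℝ} {R : ℝ} (hR : R ≠ 0) {s : Set ℂ}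
    (hs : s.Countable) (h₁ : CircleIntegrable f₁ 0 R) (h₂ : CircleIntegrable f₂ 0 R)
    (h : ∀ z ∈ sphere (0 : ℂ) |R|, z ∉ s → f₁ z = f₂ z) :
    Real.circleAverage f₁ 0 R = Real.circleAverage f₂ 0 R :=
  le_antisymm (circleAverage_mono_off_countable hR hs h₁ h₂ fun z hz hzs => (h z hz hzs).le)
    (circleAverage_mono_off_countable hR hs h₂ h₁ fun z hz hzs => (h z hz hzs).ge)

variable {f : ℂ → ℂ}

lemma circleIntegrable_log_norm_of_entire (hf : Differentiable ℂ f) (R : ℝ) :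
    CircleIntegrable (fun z => Real.log ‖f z‖) 0 R :=
  MeromorphicOn.circleIntegrable_log_norm fun z _ => (hf.analyticAt z).meromorphicAt

lemma circleIntegrable_logPlus_of_entire (hf : Differentiable ℂ f) (R : ℝ) :
    CircleIntegrable (fun z => logPlus ‖f z‖) 0 R := by
  have : CircleIntegrable (fun z => Real.posLog ‖f z‖) 0 R :=
    MeromorphicOn.circleIntegrable_posLog_norm fun z _ => (hf.analyticAt z).meromorphicAt
  simpa only [Real.posLog, logPlus, max_comm] using this

lemma nevCharEntire_eq_circleAverage (f : ℂ → ℂ) (R : ℝ) :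
    nevCharEntire f R = Real.circleAverage (fun z => logPlus ‖f z‖) 0 R := by
  simp [nevCharEntire, Real.circleAverage_def, circleMap]

lemma logPlus_nonneg (x : ℝ) : 0 ≤ logPlus x := le_max_right _ _

lemma nevCharEntire_nonneg (f : ℂ → ℂ) (R : ℝ) : 0 ≤ nevCharEntire f R := by
  rw [nevCharEntire_eq_circleAverage]
  exact Real.circleAverage_nonneg_of_nonneg fun z _ => logPlus_nonneg _

/-- The weight `‖a‖` of a zero `a` in Jensen's formula, replaced by `1` at the origin. -/
def zeroRadius (a : ℂ) : ℝ := open Classical in if a = 0 then 1 else ‖a‖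

lemma zeroRadius_pos (a : ℂ) : 0 < zeroRadius a := by
  unfold zeroRadius
  split_ifs with h
  · exact one_pos
  · exact norm_pos_iff.mpr h

lemma zeroRadius_le {a : ℂ} {R : ℝ} (hR : 1 ≤ R) (h : ‖a‖ ≤ R) : zeroRadius a ≤ R := by
  unfold zeroRadius
  split_ifs <;> assumption

lemma prod_zerosIn_eq (hf : Differentiable ℂ f) (h0 : ∃ z, f z ≠ 0) {R : ℝ} (hR : 0 ≤ R) (z : ℂ) :
    ∏ a ∈ zerosIn f R, (z - a) ^ zeroMult f a =
      z ^ zeroMult f 0 * ∏ a ∈ (zerosIn f R).erase 0, (z - a) ^ zeroMult f a := by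
  by_cases h : (0 : ℂ) ∈ zerosIn f R
  · rw [← Finset.mul_prod_erase _ _ h, sub_zero]
  · rw [Finset.erase_eq_of_notMem h]
    have : f 0 ≠ 0 := fun h2 => h ((mem_zerosIn hf h0).mpr ⟨by simpa using hR, h2⟩)
    rw [(zeroMult_eq_zero_iff hf h0 0).mpr this, pow_zero, one_mul]

lemma factor_at_zero_eq (hf : Differentiable ℂ f) (h0 : ∃ z, f z ≠ 0) {R : ℝ} (hR : 0 ≤ R)
    {g h : ℂ → ℂ} (hg : Differentiable ℂ g) (hh : Differentiable ℂ h)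
    (hfg : ∀ z, f z = (∏ a ∈ zerosIn f R, (z - a) ^ zeroMult f a) * g z)
    (hfh : ∀ z, f z = (z - 0) ^ zeroMult f 0 * h z) :
    h 0 = (∏ a ∈ (zerosIn f R).erase 0, (0 - a) ^ zeroMult f a) * g 0 := by
  have hd : Dense ({0}ᶜ : Set ℂ) := dense_compl_singleton 0
  have := Continuous.ext_on hd hh.continuous
    (g := fun z => (∏ a ∈ (zerosIn f R).erase 0, (z - a) ^ zeroMult f a) * g z)
    (by have := hg.continuous; fun_prop) fun z hz => ?_
  · exact congrFun this 0
  · have h1 := hfg z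
    rw [hfh z, prod_zerosIn_eq hf h0 hR, sub_zero, mul_assoc] at h1
    exact mul_left_cancel₀ (pow_ne_zero _ hz) h1

lemma integral_indicator_inv {b R : ℝ} (hb : 0 < b) (hbR : b ≤ R) :
    IntervalIntegrable ((Set.Ici b).indicator fun t : ℝ => t⁻¹) volume 0 R ∧
      ∫ t in (0 : ℝ)..R, (Set.Ici b).indicator (fun t : ℝ => t⁻¹) t = Real.log R - Real.log b := by
  have hR : 0 < R := hb.trans_le hbR
  have hset : Set.Ici b ∩ Set.Ioc 0 R = Set.Icc b R := by
    ext t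
    simp only [Set.mem_inter_iff, Set.mem_Ici, Set.mem_Ioc, Set.mem_Icc]
    constructor
    · rintro ⟨h1, -, h2⟩; exact ⟨h1, h2⟩
    · rintro ⟨h1, h2⟩; exact ⟨h1, hb.trans_le h1, h2⟩
  have hint : IntervalIntegrable (fun t : ℝ => t⁻¹) volume b R := by
    refine intervalIntegral.intervalIntegrable_inv (fun t ht => ?_) continuousOn_id
    rw [Set.uIcc_of_le hbR] at ht
    exact (hb.trans_le ht.1).ne'
  constructor
  · rw [intervalIntegrable_iff_integrableOn_Ioc_of_le hR.le,
      integrableOn_indicator_iff measurableSet_Ici, hset, integrableOn_Icc_iff_integrableOn_Ioc]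
    exact (intervalIntegrable_iff_integrableOn_Ioc_of_le hbR).mp hint
  · rw [intervalIntegral.integral_of_le hR.le, setIntegral_indicator measurableSet_Ici,
      Set.inter_comm, hset, integral_Icc_eq_integral_Ioc,
      ← intervalIntegral.integral_of_le hbR, integral_inv_of_pos hb hR,
      Real.log_div hR.ne' hb.ne']

lemma integZeroCount_eq_sum (hf : Differentiable ℂ f) (h0 : ∃ z, f z ≠ 0) {R : ℝ} (hR : 0 < R) :
    integZeroCount f R =
      ∑ a ∈ zerosIn f R, zeroMult f a * (Real.log R - Real.log (zeroRadius a)) := by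
  have key : ∀ a ∈ (zerosIn f R).erase 0, 0 < ‖a‖ ∧ ‖a‖ ≤ R := by
    intro a ha
    rw [Finset.mem_erase, mem_zerosIn hf h0] at ha
    exact ⟨norm_pos_iff.mpr ha.1, ha.2.1⟩
  have hint : ∫ t in (0 : ℝ)..R, ((zeroCount f t : ℝ) - (zeroCount f 0 : ℝ)) / t =
      ∑ a ∈ (zerosIn f R).erase 0, (zeroMult f a : ℝ) * (Real.log R - Real.log ‖a‖) := by
    rw [← Finset.sum_congr rfl fun a ha => by
      rw [← (integral_indicator_inv (key a ha).1 (key a ha).2).2,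
        ← intervalIntegral.integral_const_mul],
      ← intervalIntegral.integral_finsetSum fun a ha =>
        (integral_indicator_inv (key a ha).1 (key a ha).2).1.const_mul _]
    refine intervalIntegral.integral_congr fun t ht => ?_
    rw [Set.uIcc_of_le hR.le] at ht
    rw [zeroCount_eq_sum_ite hf h0 ht.2, zeroCount_eq_sum_ite hf h0 hR.le,
      ← Finset.sum_sub_distrib, Finset.sum_div]
    have hz : ∀ a ∈ zerosIn f R, a ∉ (zerosIn f R).erase 0 →
        ((if ‖a‖ ≤ t then (zeroMult f a : ℝ) else 0) - if ‖a‖ ≤ 0 then (zeroMult f a : ℝ) else 0)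
          / t = 0 := by
      intro a ha ha2
      have : a = 0 := by
        by_contra h
        exact ha2 (Finset.mem_erase.mpr ⟨h, ha⟩)
      subst this
      simp [ht.1]
    rw [← Finset.sum_subset (Finset.erase_subset _ _) hz]
    refine Finset.sum_congr rfl fun a ha => ?_
    rw [if_neg (not_le.mpr (key a ha).1), sub_zero, Set.indicator_apply]
    simp only [Set.mem_Ici]
    split_ifs
    · rw [div_eq_mul_inv]
    · simp
  rw [integZeroCount, hint, zeroCount_zero hf h0]
  have hrest : ∀ a ∈ (zerosIn f R).erase 0,
      (zeroMult f a : ℝ) * (Real.log R - Real.log ‖a‖) =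
        zeroMult f a * (Real.log R - Real.log (zeroRadius a)) := by
    intro a ha
    rw [zeroRadius, if_neg (Finset.mem_erase.mp ha).1]
  rw [Finset.sum_congr rfl hrest]
  by_cases h : (0 : ℂ) ∈ zerosIn f R
  · rw [← Finset.add_sum_erase _ _ h]
    simp [zeroRadius]
  · have : f 0 ≠ 0 := fun h2 => h ((mem_zerosIn hf h0).mpr ⟨by simpa using hR.le, h2⟩)
    rw [Finset.erase_eq_of_notMem h, (zeroMult_eq_zero_iff hf h0 0).mpr this]
    simp

lemma log_norm_factor (hf : Differentiable ℂ f) (h0 : ∃ z, f z ≠ 0) {R : ℝ} {g : ℂ → ℂ}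
    (hfg : ∀ z, f z = (∏ a ∈ zerosIn f R, (z - a) ^ zeroMult f a) * g z) {z : ℂ} (hz : f z ≠ 0) :
    Real.log ‖f z‖ = ∑ a ∈ zerosIn f R, zeroMult f a * Real.log ‖z - a‖ + Real.log ‖g z‖ := by
  have hne : ∀ a ∈ zerosIn f R, ‖z - a‖ ≠ 0 := by
    intro a ha
    rw [norm_ne_zero_iff, sub_ne_zero]
    rintro rfl
    exact hz ((mem_zerosIn hf h0).mp ha).2
  have hg : ‖g z‖ ≠ 0 := by
    rw [norm_ne_zero_iff]
    intro h
    exact hz (by rw [hfg, h, mul_zero])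
  rw [hfg z, norm_mul, norm_prod, Real.log_mul _ hg, Real.log_prod]
  · congr 1
    refine Finset.sum_congr rfl fun a ha => ?_
    rw [norm_pow, Real.log_pow]
  · intro a ha
    rw [norm_pow]
    exact pow_ne_zero _ (hne a ha)
  · refine Finset.prod_ne_zero_iff.mpr fun a ha => ?_
    rw [norm_pow]
    exact pow_ne_zero _ (hne a ha)

lemma exists_circleAverage_log_norm_eq (hf : Differentiable ℂ f) (h0 : ∃ z, f z ≠ 0) :
    ∃ K : ℝ, ∀ R : ℝ, 0 < R →
      Real.circleAverage (fun z => Real.log ‖f z‖) 0 R = integZeroCount f R + K := by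
  obtain ⟨h, hh, hh0, hfh⟩ := exists_factor_zeroMult hf h0 0
  refine ⟨Real.log ‖h 0‖, fun R hR => ?_⟩
  obtain ⟨g, hg, hgne, hfg⟩ := exists_factor_zerosIn hf h0 R
  have hI : ∀ a ∈ zerosIn f R,
      CircleIntegrable (fun z : ℂ => (zeroMult f a : ℝ) * Real.log ‖z - a‖) 0 R := by
    intro a _
    exact (circleIntegrable_log_norm_of_entire (f := fun z => z - a) (by fun_prop) R).const_mul _
  have hI2 : CircleIntegrable (fun z => ∑ a ∈ zerosIn f R,
      (zeroMult f a : ℝ) * Real.log ‖z - a‖) 0 R := CircleIntegrable.fun_sum _ hI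
  have hsum : Real.circleAverage (fun z => Real.log ‖f z‖) 0 R =
      Real.circleAverage (fun z => ∑ a ∈ zerosIn f R, zeroMult f a * Real.log ‖z - a‖
        + Real.log ‖g z‖) 0 R := by
    refine circleAverage_congr_off_countable hR.ne' (s := (zerosIn f R : Set ℂ))
      (Finset.countable_toSet _) (circleIntegrable_log_norm_of_entire hf R)
      (hI2.add (circleIntegrable_log_norm_of_entire hg R)) fun z hz hzs => ?_
    refine log_norm_factor hf h0 hfg fun h => hzs ?_
    rw [abs_of_pos hR] at hz
    exact (mem_zerosIn hf h0).mpr ⟨by simpa using hz.le, h⟩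
  rw [hsum, Real.circleAverage_fun_add hI2 (circleIntegrable_log_norm_of_entire hg R),
    Real.circleAverage_fun_sum hI,
    AnalyticOnNhd.circleAverage_log_norm_of_ne_zero (fun z _ => hg.analyticAt z)
      (fun u hu => hgne u (by simpa [abs_of_pos hR] using hu)),
    integZeroCount_eq_sum hf h0 hR, factor_at_zero_eq hf h0 hR.le hg hh hfg hfh]
  have h1 : ∀ a ∈ zerosIn f R,
      Real.circleAverage (fun z : ℂ => (zeroMult f a : ℝ) * Real.log ‖z - a‖) 0 R =
        zeroMult f a * Real.log R := by
    intro a ha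
    have := Real.circleAverage_fun_smul (f := fun z : ℂ => Real.log ‖z - a‖) (c := 0) (R := R)
      (a := (zeroMult f a : ℝ))
    simp only [smul_eq_mul] at this
    rw [this, circleAverage_log_norm_sub_const_of_mem_closedBall]
    simpa [abs_of_pos hR] using ((mem_zerosIn hf h0).mp ha).1
  have hg0 : ‖g 0‖ ≠ 0 := norm_ne_zero_iff.mpr (hgne 0 (by simpa using hR.le))
  have hne : ∀ a ∈ (zerosIn f R).erase 0, ‖(0 - a) ^ zeroMult f a‖ ≠ 0 := by
    intro a ha
    simpa using fun h => absurd h (Finset.mem_erase.mp ha).1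
  rw [Finset.sum_congr rfl h1, norm_mul, norm_prod,
    Real.log_mul (Finset.prod_ne_zero_iff.mpr hne) hg0, Real.log_prod hne]
  have h2 : ∑ a ∈ (zerosIn f R).erase 0, Real.log ‖(0 - a) ^ zeroMult f a‖ =
      ∑ a ∈ zerosIn f R, zeroMult f a * Real.log (zeroRadius a) := by
    rw [← Finset.sum_subset (Finset.erase_subset 0 (zerosIn f R))]
    · refine Finset.sum_congr rfl fun a ha => ?_
      rw [norm_pow, Real.log_pow, zero_sub, norm_neg, zeroRadius,
        if_neg (Finset.mem_erase.mp ha).1]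
    · intro a ha ha2
      have : a = 0 := by
        by_contra h
        exact ha2 (Finset.mem_erase.mpr ⟨h, ha⟩)
      simp [this, zeroRadius]
  rw [h2]
  simp only [mul_sub, Finset.sum_sub_distrib]
  ring

lemma zeroCount_mul_log_two_le (hf : Differentiable ℂ f) (h0 : ∃ z, f z ≠ 0) {R : ℝ}
    (hR : 1 ≤ R) : zeroCount f R * Real.log 2 ≤ integZeroCount f (2 * R) := by
  rw [integZeroCount_eq_sum hf h0 (by linarith), zeroCount_eq_sum_zerosIn hf h0, Nat.cast_sum,
    Finset.sum_mul]
  refine (Finset.sum_le_sum fun a ha => ?_).trans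
    (Finset.sum_le_sum_of_subset_of_nonneg (zerosIn_mono hf h0 (by linarith)) fun a ha _ => ?_)
  · have h1 := Real.log_le_log (zeroRadius_pos a) (zeroRadius_le hR ((mem_zerosIn hf h0).mp ha).1)
    rw [Real.log_mul two_ne_zero (by linarith)]
    gcongr
    linarith
  · have h1 := Real.log_le_log (zeroRadius_pos a)
      (zeroRadius_le (by linarith) ((mem_zerosIn hf h0).mp ha).1)
    exact mul_nonneg (Nat.cast_nonneg _) (sub_nonneg.mpr h1)

lemma integZeroCount_mono (hf : Differentiable ℂ f) (h0 : ∃ z, f z ≠ 0) {r R : ℝ}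
    (hr : 1 ≤ r) (hrR : r ≤ R) : integZeroCount f r ≤ integZeroCount f R := by
  rw [integZeroCount_eq_sum hf h0 (by linarith), integZeroCount_eq_sum hf h0 (by linarith)]
  refine (Finset.sum_le_sum fun a ha => ?_).trans
    (Finset.sum_le_sum_of_subset_of_nonneg (zerosIn_mono hf h0 hrR) fun a ha _ => ?_)
  · have := Real.log_le_log (by linarith) hrR
    gcongr
  · have h1 := Real.log_le_log (zeroRadius_pos a)
      (zeroRadius_le (by linarith) ((mem_zerosIn hf h0).mp ha).1)
    exact mul_nonneg (Nat.cast_nonneg _) (sub_nonneg.mpr h1)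

lemma integZeroCount_nonneg (hf : Differentiable ℂ f) (h0 : ∃ z, f z ≠ 0) {R : ℝ}
    (hR : 1 ≤ R) : 0 ≤ integZeroCount f R := by
  rw [integZeroCount_eq_sum hf h0 (by linarith)]
  refine Finset.sum_nonneg fun a ha => mul_nonneg (Nat.cast_nonneg _) (sub_nonneg.mpr ?_)
  exact Real.log_le_log (zeroRadius_pos a) (zeroRadius_le hR ((mem_zerosIn hf h0).mp ha).1)

end Jensen

section MaximumModulus

variable {f : ℂ → ℂ}

lemma poissonKernel_nonneg_le_three {R : ℝ} (hR : 0 < R) {z w : ℂ} (hz : z ∈ sphere (0 : ℂ) R)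
    (hw : ‖w‖ ≤ R / 2) : 0 ≤ poissonKernel 0 w z ∧ poissonKernel 0 w z ≤ 3 := by
  have hw' : w ∈ ball (0 : ℂ) R := by simpa using by linarith
  have hn := norm_nonneg w
  have h1 := le_re_herglotzRieszKernel hz hw'
  have h2 := re_herglotzRieszKernel_le hz hw'
  rw [poissonKernel_eq_re_herglotzRieszKernel]
  simp only [sub_zero, Function.comp_apply, herglotzRieszKernel] at *
  refine ⟨le_trans (div_nonneg (by linarith) (by linarith)) h1, h2.trans ?_⟩
  rw [div_le_iff₀ (by linarith)]
  linarith

lemma log_norm_le_nevCharEntire_add (hf : Differentiable ℂ f) (h0 : ∃ z, f z ≠ 0) {R : ℝ}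
    (hR : 0 < R) {w : ℂ} (hw : ‖w‖ ≤ R / 2) :
    Real.log ‖f w‖ ≤ 3 * nevCharEntire f R + 3 * (zeroCount f R * Real.log 2) := by
  have hT : 0 ≤ nevCharEntire f R := nevCharEntire_nonneg f R
  have hlog2 : 0 ≤ Real.log 2 := Real.log_nonneg one_le_two
  by_cases hfw : f w = 0
  · rw [hfw, norm_zero, Real.log_zero]
    positivity
  obtain ⟨g, hg, hgne, hfg⟩ := exists_factor_zerosIn hf h0 R
  set b : ℂ := (2 * R : ℂ) ^ zeroCount f R with hb
  have hb0 : b ≠ 0 := pow_ne_zero _ (by norm_cast; positivity)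
  have hblog : Real.log ‖b‖ = zeroCount f R * Real.log (2 * R) := by
    rw [hb, norm_pow, Real.log_pow]
    congr 2
    simp [abs_of_pos hR]
  have hcount : (zeroCount f R : ℝ) * Real.log (2 * R) =
      ∑ a ∈ zerosIn f R, zeroMult f a * Real.log (2 * R) := by
    rw [zeroCount_eq_sum_zerosIn hf h0, Nat.cast_sum, Finset.sum_mul]
  set u : ℂ → ℝ := fun z => Real.log ‖b * g z‖ with hu
  have hu_eq : ∀ z, ‖z‖ ≤ R → f z ≠ 0 → u z = Real.log ‖f z‖ +
      ∑ a ∈ zerosIn f R, zeroMult f a * (Real.log (2 * R) - Real.log ‖z - a‖) := by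
    intro z hz hfz
    rw [log_norm_factor hf h0 hfg hfz, hu]
    simp only
    rw [norm_mul, Real.log_mul (by simpa using hb0) (by simpa using hgne z hz), hblog, hcount]
    simp only [mul_sub, Finset.sum_sub_distrib]
    ring
  have hne : ∀ z, f z ≠ 0 → ∀ a ∈ zerosIn f R, 0 < ‖z - a‖ := by
    intro z hz a ha
    rw [norm_pos_iff, sub_ne_zero]
    rintro rfl
    exact hz ((mem_zerosIn hf h0).mp ha).2
  have hterm : ∀ z, ‖z‖ ≤ R → f z ≠ 0 → ∀ a ∈ zerosIn f R,
      0 ≤ (zeroMult f a : ℝ) * (Real.log (2 * R) - Real.log ‖z - a‖) := by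
    intro z hz hfz a ha
    have ha' := ((mem_zerosIn hf h0).mp ha).1
    exact mul_nonneg (Nat.cast_nonneg _) (sub_nonneg.mpr
      (Real.log_le_log (hne z hfz a ha) ((norm_sub_le _ _).trans (by linarith))))
  have hwR : ‖w‖ ≤ R := by linarith
  have hle : Real.log ‖f w‖ ≤ u w := by
    rw [hu_eq w hwR hfw]
    linarith [Finset.sum_nonneg (hterm w hwR hfw)]
  have hI : ∀ a ∈ zerosIn f R, CircleIntegrable
      (fun z : ℂ => (zeroMult f a : ℝ) * (Real.log (2 * R) - Real.log ‖z - a‖)) 0 R := by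
    intro a _
    exact ((circleIntegrable_const _ _ _).sub
      (circleIntegrable_log_norm_of_entire (f := fun z => z - a) (by fun_prop) R)).const_mul _
  have hI2 := CircleIntegrable.fun_sum _ hI
  have hharm : InnerProductSpace.HarmonicOnNhd u (closedBall 0 R) := by
    intro z hz
    refine AnalyticAt.harmonicAt_log_norm ((hg.const_mul b).analyticAt z) (mul_ne_zero hb0 ?_)
    exact hgne z (by simpa using hz)
  have hcont : ContinuousOn (poissonKernel 0 w • u) (sphere 0 R) := by
    refine ContinuousOn.smul ?_ ?_
    · unfold poissonKernel
      refine ContinuousOn.div (by fun_prop) (by fun_prop) fun z hz => ?_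
      have : ‖z‖ = R := by simpa using hz
      refine pow_ne_zero _ (norm_ne_zero_iff.mpr ?_)
      rw [sub_zero, sub_zero, sub_ne_zero]
      rintro rfl
      linarith
    · refine ContinuousOn.log (by have := hg.continuous; fun_prop) fun z hz => ?_
      rw [norm_ne_zero_iff]
      exact mul_ne_zero hb0 (hgne z (by simpa using (show ‖z‖ = R by simpa using hz).le))
  have hT3 : Real.circleAverage (fun z => 3 * (logPlus ‖f z‖ +
      ∑ a ∈ zerosIn f R, zeroMult f a * (Real.log (2 * R) - Real.log ‖z - a‖))) 0 R =
      3 * nevCharEntire f R + 3 * (zeroCount f R * Real.log 2) := by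
    have h3 := Real.circleAverage_fun_smul (f := fun z : ℂ => logPlus ‖f z‖ +
      ∑ a ∈ zerosIn f R, zeroMult f a * (Real.log (2 * R) - Real.log ‖z - a‖)) (c := 0) (R := R)
      (a := (3 : ℝ))
    simp only [smul_eq_mul] at h3
    have hav : ∀ a ∈ zerosIn f R, Real.circleAverage (fun z : ℂ =>
        (zeroMult f a : ℝ) * (Real.log (2 * R) - Real.log ‖z - a‖)) 0 R =
        zeroMult f a * Real.log 2 := by
      intro a ha
      have h4 := Real.circleAverage_fun_smul (c := 0) (R := R) (a := (zeroMult f a : ℝ))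
        (f := fun z : ℂ => Real.log (2 * R) - Real.log ‖z - a‖)
      simp only [smul_eq_mul] at h4
      rw [h4, Real.circleAverage_fun_sub (circleIntegrable_const _ _ _)
        (circleIntegrable_log_norm_of_entire (f := fun z => z - a) (by fun_prop) R),
        Real.circleAverage_const, circleAverage_log_norm_sub_const_of_mem_closedBall,
        Real.log_mul two_ne_zero hR.ne']
      · ring
      · simpa [abs_of_pos hR] using ((mem_zerosIn hf h0).mp ha).1
    rw [h3, Real.circleAverage_fun_add (circleIntegrable_logPlus_of_entire hf R) hI2,
      Real.circleAverage_fun_sum hI, Finset.sum_congr rfl hav, nevCharEntire_eq_circleAverage,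
      zeroCount_eq_sum_zerosIn hf h0, Nat.cast_sum, Finset.sum_mul]
    ring
  rw [← hT3]
  refine hle.trans ?_
  rw [← hharm.circleAverage_poissonKernel_smul (by simpa using by linarith)]
  refine circleAverage_mono_off_countable hR.ne' (s := (zerosIn f R : Set ℂ))
    (Finset.countable_toSet _) (hcont.circleIntegrable hR.le)
    (((circleIntegrable_logPlus_of_entire hf R).add hI2).const_mul 3) fun z hz hzs => ?_
  rw [abs_of_pos hR] at hz
  have hzR : ‖z‖ ≤ R := (show ‖z‖ = R by simpa using hz).le
  have hfz : f z ≠ 0 := fun h => hzs ((mem_zerosIn hf h0).mpr ⟨hzR, h⟩)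
  obtain ⟨hP0, hP3⟩ := poissonKernel_nonneg_le_three hR hz hw
  have hsum := Finset.sum_nonneg (hterm z hzR hfz)
  have hlp : Real.log ‖f z‖ ≤ logPlus ‖f z‖ := le_max_left _ _
  have hlp0 : 0 ≤ logPlus ‖f z‖ := logPlus_nonneg _
  rw [Pi.smul_apply', smul_eq_mul, hu_eq z hzR hfz]
  exact (mul_le_mul_of_nonneg_left (by linarith) hP0).trans
    (mul_le_mul_of_nonneg_right hP3 (add_nonneg hlp0 hsum))

end MaximumModulus

section FiniteOrder

variable {f : ℂ → ℂ}

lemma exists_integZeroCount_le (hf : Differentiable ℂ f) (h0 : ∃ z, f z ≠ 0) :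
    ∃ K : ℝ, 0 ≤ K ∧ ∀ R : ℝ, 0 < R → integZeroCount f R ≤ nevCharEntire f R + K := by
  obtain ⟨K, hK⟩ := exists_circleAverage_log_norm_eq hf h0
  refine ⟨|K|, abs_nonneg K, fun R hR => ?_⟩
  have h : Real.circleAverage (fun z => Real.log ‖f z‖) 0 R ≤ nevCharEntire f R := by
    rw [nevCharEntire_eq_circleAverage]
    exact Real.circleAverage_mono (circleIntegrable_log_norm_of_entire hf R)
      (circleIntegrable_logPlus_of_entire hf R) fun z _ => le_max_left _ _
  linarith [hK R hR, neg_abs_le K]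

lemma exists_nevCharEntire_le_pow (hord : growthOrderEntire f < ⊤) :
    ∃ (K : ℕ) (r₀ : ℝ), 1 ≤ r₀ ∧ ∀ r, r₀ ≤ r → nevCharEntire f r ≤ r ^ K := by
  obtain ⟨x, hx, -⟩ := EReal.lt_iff_exists_real_btwn.mp hord
  obtain ⟨r₁, hr₁⟩ := Filter.eventually_atTop.mp (Filter.eventually_lt_of_limsup_lt hx)
  obtain ⟨K, hK⟩ := exists_nat_ge x
  refine ⟨K, max r₁ 2, le_max_of_le_right one_le_two, fun r hr => ?_⟩
  have hr2 : 2 ≤ r := (le_max_right _ _).trans hr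
  have h1 := EReal.coe_lt_coe_iff.mp (hr₁ r ((le_max_left _ _).trans hr))
  have hlog : 0 < Real.log r := Real.log_pos (by linarith)
  rw [div_lt_iff₀ hlog] at h1
  calc nevCharEntire f r ≤ Real.exp (Real.log (nevCharEntire f r)) := Real.le_exp_log _
    _ ≤ Real.exp (K * Real.log r) := by
        refine Real.exp_le_exp.mpr ((le_max_left _ _).trans (h1.le.trans ?_))
        gcongr
    _ = r ^ K := by
        rw [← Real.log_pow, Real.exp_log (by positivity)]

lemma exists_norm_le_exp_pow (hf : Differentiable ℂ f) (h0 : ∃ z, f z ≠ 0)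
    (hord : growthOrderEntire f < ⊤) :
    ∃ (A : ℝ) (K : ℕ), 0 ≤ A ∧ ∀ z, ‖f z‖ ≤ Real.exp (A * (1 + ‖z‖) ^ K) := by
  obtain ⟨K, r₀, hr₀, hT⟩ := exists_nevCharEntire_le_pow hord
  obtain ⟨D, hD0, hD⟩ := exists_integZeroCount_le hf h0
  refine ⟨(3 + 3 * 2 ^ K + 3 * D) * (2 + r₀) ^ K, K, by positivity, fun z => ?_⟩
  refine (Real.le_exp_log _).trans (Real.exp_le_exp.mpr ?_)
  have hz := norm_nonneg z
  set R := 2 * ‖z‖ + r₀ with hR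
  have hR1 : 1 ≤ R := by linarith
  have h1 := log_norm_le_nevCharEntire_add hf h0 (R := R) (w := z) (by linarith) (by linarith)
  have h2 := zeroCount_mul_log_two_le hf h0 hR1
  have h3 := hD (2 * R) (by linarith)
  have h4 := hT R (by linarith)
  have h5 := hT (2 * R) (by linarith)
  rw [mul_pow] at h5
  have h6 : (1 : ℝ) ≤ R ^ K := one_le_pow₀ hR1
  have h7 : R ^ K ≤ (2 + r₀) ^ K * (1 + ‖z‖) ^ K := by
    rw [← mul_pow]
    gcongr
    nlinarith
  calc Real.log ‖f z‖ ≤ (3 + 3 * 2 ^ K) * R ^ K + 3 * D := by linarith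
    _ ≤ (3 + 3 * 2 ^ K + 3 * D) * R ^ K := by nlinarith
    _ ≤ _ := by rw [mul_assoc]; gcongr

end FiniteOrder

section ExponentialType

/-- Iterating a self-improving bound `ψ³ ≤ …` turns a bound of finite order into one of
exponential type. -/
lemma exists_linear_bound_of_cubic_improvement {u : ℂ → ℝ} {D d : ℝ} (hD : 0 ≤ D) (hd : 0 ≤ d)
    {A : ℝ} (hA : 0 ≤ A) {K : ℕ} (h0 : ∀ z, u z ≤ A * (1 + ‖z‖) ^ K)
    (step : ∀ φ : ℝ → ℝ, MonotoneOn φ (Set.Ici 0) → (∀ x, 0 ≤ x → 0 ≤ φ x) →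
      (∀ z, u z ≤ φ ‖z‖) → ∀ z, 3 * u z ≤ D * (1 + ‖z‖) + φ (‖z‖ + d)) :
    ∀ z, u z ≤ D * ‖z‖ + (D + D * d) := by
  have key : ∀ j : ℕ, ∀ z, u z ≤ D * ‖z‖ + (D + D * d) + A * (1 + ‖z‖ + j * d) ^ K / 3 ^ j := by
    intro j
    induction j with
    | zero =>
      intro z
      have := h0 z
      have : 0 ≤ D * ‖z‖ + (D + D * d) := by positivity
      simp
      linarith
    | succ j ih =>
      intro z
      have := step (fun x => D * x + (D + D * d) + A * (1 + x + j * d) ^ K / 3 ^ j)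
        (by
          intro x hx y hy hxy
          have : (0:ℝ) ≤ x := hx
          simp only
          gcongr) (by intro x hx; positivity) ih z
      have hDd : 0 ≤ D * d := by positivity
      have hDz : 0 ≤ D * ‖z‖ := by positivity
      have e : A * (1 + (‖z‖ + d) + j * d) ^ K / 3 ^ j =
          3 * (A * (1 + ‖z‖ + ((j + 1 : ℕ) : ℝ) * d) ^ K / 3 ^ (j + 1)) := by
        push_cast
        rw [pow_succ]
        field_simp
        ring_nf
      rw [e] at this
      linarith
  intro z
  have hlim : Tendsto (fun j : ℕ => D * ‖z‖ + (D + D * d) + A * (1 + ‖z‖ + j * d) ^ K / 3 ^ j)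
      atTop (nhds (D * ‖z‖ + (D + D * d) + 0)) := by
    refine tendsto_const_nhds.add ?_
    have h1 : Tendsto (fun j : ℕ => A * (1 + ‖z‖ + d) ^ K * ((j + 1 : ℝ) ^ K / 3 ^ j)) atTop
        (nhds (A * (1 + ‖z‖ + d) ^ K * 0)) := by
      refine Tendsto.const_mul _ ?_
      have h2 := tendsto_pow_const_div_const_pow_of_one_lt K (r := (3:ℝ)) (by norm_num)
      have h3 := ((tendsto_add_atTop_iff_nat 1).mpr h2).const_mul 3
      rw [mul_zero] at h3
      refine h3.congr fun j => ?_
      push_cast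
      rw [pow_succ 3 j]
      field_simp
    rw [mul_zero] at h1
    refine squeeze_zero (fun j => by positivity) (fun j => ?_) h1
    rw [mul_assoc, ← mul_div_assoc, ← mul_pow, ← mul_div_assoc]
    gcongr
    have : 0 ≤ ‖z‖ := norm_nonneg z
    have : (0:ℝ) ≤ j := Nat.cast_nonneg j
    nlinarith [mul_nonneg this (norm_nonneg z)]
  rw [add_zero] at hlim
  exact ge_of_tendsto' hlim fun j => key j z

end ExponentialType

section ExponentialType

variable {f : ℂ → ℂ}

lemma norm_exp_mul_le (α z : ℂ) : ‖Complex.exp (α * z)‖ ≤ Real.exp (‖α‖ * ‖z‖) := by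
  rw [Complex.norm_exp, Real.exp_le_exp, ← norm_mul]
  exact Complex.re_le_norm _

lemma norm_exp_sum_le (p₁ p₂ α₁ α₂ z : ℂ) :
    ‖p₁ * Complex.exp (α₁ * z) + p₂ * Complex.exp (α₂ * z)‖ ≤
      (‖p₁‖ + ‖p₂‖) * Real.exp ((‖α₁‖ + ‖α₂‖) * ‖z‖) := by
  have h1 := norm_exp_mul_le α₁ z
  have h2 := norm_exp_mul_le α₂ z
  have hz := norm_nonneg z
  refine (norm_add_le _ _).trans ?_
  rw [norm_mul, norm_mul, add_mul]
  gcongr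
  · exact h1.trans (Real.exp_le_exp.mpr (by nlinarith [norm_nonneg α₂]))
  · exact h2.trans (Real.exp_le_exp.mpr (by nlinarith [norm_nonneg α₁]))

lemma norm_iteratedDeriv_le_of_forall_closedBall (hf : Differentiable ℂ f) (k : ℕ) (z : ℂ)
    {B : ℝ} (hB : ∀ t : ℂ, ‖t‖ ≤ 1 → ‖f (z + t)‖ ≤ B) :
    ‖iteratedDeriv k f z‖ ≤ k.factorial * B := by
  have := Complex.norm_iteratedDeriv_le_of_forall_mem_sphere_norm_le (c := z) (C := B) k one_pos
    hf.diffContOnCl fun ζ hζ => by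
      have h := hB (ζ - z) (by simpa [dist_eq_norm] using (mem_sphere.mp hζ).le)
      rwa [add_sub_cancel] at h
  simpa using this

lemma three_mul_log_norm_le (hf : Differentiable ℂ f) {k : ℕ} {c w p₁ p₂ α₁ α₂ : ℂ} (hw : w ≠ 0)
    (heq : ∀ z : ℂ, f z ^ 3 + w * f z ^ 2 * deriv f z + iteratedDeriv k f (z + c)
      = p₁ * Complex.exp (α₁ * z) + p₂ * Complex.exp (α₂ * z)) :
    ∃ D : ℝ, 0 ≤ D ∧ ∀ φ : ℝ → ℝ, MonotoneOn φ (Set.Ici 0) → (∀ x, 0 ≤ x → 0 ≤ φ x) →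
      (∀ z, Real.log ‖f z‖ ≤ φ ‖z‖) →
        ∀ z, 3 * Real.log ‖f z‖ ≤ D * (1 + ‖z‖) + φ (‖z‖ + (‖c‖ + 1)) := by
  set b : ℝ := 3 / ‖w‖ with hb
  set M : ℝ := ‖f 0‖ ^ 3 + (‖p₁‖ + ‖p₂‖) + k.factorial with hM
  set s : ℝ := ‖α₁‖ + ‖α₂‖ with hs
  have hb0 : 0 ≤ b := by positivity
  have hM0 : 0 ≤ M := by positivity
  have hs0 : 0 ≤ s := by positivity
  refine ⟨3 * b + s + M, by positivity, fun φ hφ hφ0 hle z => ?_⟩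
  have hx := norm_nonneg z
  have hc := norm_nonneg c
  set x := ‖z‖ with hxdef
  set y := φ (x + (‖c‖ + 1)) with hy
  have hy0 : 0 ≤ y := hφ0 _ (by positivity)
  have hfle : ∀ ζ, ‖f ζ‖ ≤ Real.exp (φ ‖ζ‖) := fun ζ =>
    (Real.le_exp_log _).trans (Real.exp_le_exp.mpr (hle ζ))
  have hV : ∀ ζ, ‖ζ‖ ≤ x → ‖iteratedDeriv k f (ζ + c)‖ ≤ k.factorial * Real.exp y := by
    intro ζ hζ
    refine norm_iteratedDeriv_le_of_forall_closedBall hf k _ fun t ht => ?_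
    refine (hfle _).trans (Real.exp_le_exp.mpr ?_)
    have : ‖ζ + c + t‖ ≤ x + (‖c‖ + 1) := by
      linarith [norm_add_le (ζ + c) t, norm_add_le ζ c]
    exact hφ (norm_nonneg _) (show (0:ℝ) ≤ x + (‖c‖ + 1) by positivity) this
  have hder : ∀ ζ, HasDerivAt (fun ζ => Complex.exp (3 / w * ζ) * f ζ ^ 3)
      (3 / w * Complex.exp (3 / w * ζ) * (p₁ * Complex.exp (α₁ * ζ) + p₂ * Complex.exp (α₂ * ζ)
        - iteratedDeriv k f (ζ + c))) ζ := by
    intro ζ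
    have h1 : HasDerivAt (fun ζ => Complex.exp (3 / w * ζ)) (Complex.exp (3 / w * ζ) * (3 / w)) ζ := by
      simpa using ((hasDerivAt_id ζ).const_mul (3 / w)).cexp
    refine (h1.mul ((hf ζ).hasDerivAt.pow 3)).congr_deriv ?_
    rw [← heq ζ]
    simp
    field_simp
  have h3w : ‖3 / w‖ = b := by rw [norm_div, hb]; simp
  have hexp : ∀ ζ, ‖ζ‖ ≤ x → ‖Complex.exp (3 / w * ζ)‖ ≤ Real.exp (b * x) := by
    intro ζ hζ
    refine (norm_exp_mul_le _ _).trans (Real.exp_le_exp.mpr ?_)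
    rw [h3w]
    gcongr
  have hmv := Convex.norm_image_sub_le_of_norm_hasDerivWithin_le
    (C := b * Real.exp (b * x) * ((‖p₁‖ + ‖p₂‖) * Real.exp (s * x) + k.factorial * Real.exp y))
    (s := closedBall (0 : ℂ) x) (fun ζ _ => (hder ζ).hasDerivWithinAt)
    (fun ζ hζ => by
      have hζ' : ‖ζ‖ ≤ x := by simpa using hζ
      rw [norm_mul, norm_mul, h3w]
      have h2 := hexp ζ hζ'
      have h3 := hV ζ hζ'
      have h4 : ‖p₁ * Complex.exp (α₁ * ζ) + p₂ * Complex.exp (α₂ * ζ)‖ ≤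
          (‖p₁‖ + ‖p₂‖) * Real.exp (s * x) := by
        refine (norm_exp_sum_le p₁ p₂ α₁ α₂ ζ).trans ?_
        gcongr
      gcongr
      exact (norm_sub_le _ _).trans (add_le_add h4 h3))
    (convex_closedBall 0 x) (x := 0) (y := z) (by simpa using hx) (by simp [hxdef])
  simp only [mul_zero, Complex.exp_zero, one_mul, sub_zero] at hmv
  have hcube : ‖Complex.exp (3 / w * z) * f z ^ 3‖ ≤ Real.exp (2 * b * x + s * x + y) * M := by
    have h5 := norm_le_insert' (Complex.exp (3 / w * z) * f z ^ 3) (f 0 ^ 3)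
    have hbx : b * x ≤ Real.exp (b * x) := by linarith [Real.add_one_le_exp (b * x)]
    have e1 : (1 : ℝ) ≤ Real.exp (2 * b * x + s * x + y) := Real.one_le_exp (by positivity)
    have e2 : Real.exp (b * x) * Real.exp (b * x) * Real.exp (s * x) ≤
        Real.exp (2 * b * x + s * x + y) := by
      rw [← Real.exp_add, ← Real.exp_add, Real.exp_le_exp]; linarith
    have e3 : Real.exp (b * x) * Real.exp (b * x) * Real.exp y ≤
        Real.exp (2 * b * x + s * x + y) := by
      rw [← Real.exp_add, ← Real.exp_add, Real.exp_le_exp]; nlinarith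
    rw [norm_pow] at h5
    calc _ ≤ _ := h5
      _ ≤ ‖f 0‖ ^ 3 + (b * x) * Real.exp (b * x) * ((‖p₁‖ + ‖p₂‖) * Real.exp (s * x)
          + k.factorial * Real.exp y) := by linarith
      _ ≤ ‖f 0‖ ^ 3 * 1 + Real.exp (b * x) * Real.exp (b * x) *
          ((‖p₁‖ + ‖p₂‖) * Real.exp (s * x) + k.factorial * Real.exp y) := by
        rw [mul_one]; gcongr
      _ = ‖f 0‖ ^ 3 * 1 + (‖p₁‖ + ‖p₂‖) * (Real.exp (b * x) * Real.exp (b * x) * Real.exp (s * x))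
          + k.factorial * (Real.exp (b * x) * Real.exp (b * x) * Real.exp y) := by ring
      _ ≤ ‖f 0‖ ^ 3 * Real.exp (2 * b * x + s * x + y)
          + (‖p₁‖ + ‖p₂‖) * Real.exp (2 * b * x + s * x + y)
          + k.factorial * Real.exp (2 * b * x + s * x + y) := by gcongr
      _ = _ := by rw [hM]; ring
  by_cases hfz : f z = 0
  · rw [hfz, norm_zero, Real.log_zero, mul_zero]
    positivity
  have hMexp : M ≤ Real.exp M := by linarith [Real.add_one_le_exp M]
  have hfin : ‖f z‖ ^ 3 ≤ Real.exp (3 * b * x + s * x + y + M) := by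
    have h6 : f z ^ 3 = Complex.exp (3 / w * -z) * (Complex.exp (3 / w * z) * f z ^ 3) := by
      rw [← mul_assoc, ← Complex.exp_add]
      simp
    rw [← norm_pow, h6, norm_mul]
    calc _ ≤ Real.exp (b * x) * (Real.exp (2 * b * x + s * x + y) * Real.exp M) := by
          gcongr
          · exact hexp _ (by rw [norm_neg])
          · exact hcube.trans (by gcongr)
      _ = _ := by rw [← Real.exp_add, ← Real.exp_add]; ring_nf
  have h7 := Real.log_le_log (by positivity) hfin
  rw [Real.log_exp, Real.log_pow] at h7
  push_cast at h7
  nlinarith [mul_nonneg hM0 hx]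

lemma exists_norm_le_exp_linear (hf : Differentiable ℂ f) (h0 : ∃ z, f z ≠ 0)
    (hord : growthOrderEntire f < ⊤) {k : ℕ} {c w p₁ p₂ α₁ α₂ : ℂ} (hw : w ≠ 0)
    (heq : ∀ z : ℂ, f z ^ 3 + w * f z ^ 2 * deriv f z + iteratedDeriv k f (z + c)
      = p₁ * Complex.exp (α₁ * z) + p₂ * Complex.exp (α₂ * z)) :
    ∃ D : ℝ, 0 ≤ D ∧ ∀ z, Real.log ‖f z‖ ≤ D * (1 + ‖z‖) := by
  obtain ⟨A, K, hA, hfA⟩ := exists_norm_le_exp_pow hf h0 hord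
  obtain ⟨D, hD, step⟩ := three_mul_log_norm_le hf hw heq
  have hd : 0 ≤ ‖c‖ + 1 := by positivity
  have := exists_linear_bound_of_cubic_improvement hD hd hA (K := K) (u := fun z => Real.log ‖f z‖)
    (fun z => by
      by_cases hfz : f z = 0
      · rw [hfz, norm_zero, Real.log_zero]
        positivity
      · have := Real.log_le_log (by positivity) (hfA z)
        rwa [Real.log_exp] at this) step
  have hDd : 0 ≤ D * (‖c‖ + 1) := by positivity
  refine ⟨D + D * (‖c‖ + 1), by positivity, fun z => (this z).trans ?_⟩
  nlinarith [mul_nonneg hDd (norm_nonneg z)]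

end ExponentialType

section FewZeros

variable {f : ℂ → ℂ}

lemma nevCharEntire_le_linear (hf : Differentiable ℂ f) {D : ℝ} (hD0 : 0 ≤ D)
    (hD : ∀ z, Real.log ‖f z‖ ≤ D * (1 + ‖z‖)) {r : ℝ} (hr : 0 ≤ r) :
    nevCharEntire f r ≤ D * (1 + r) := by
  rw [nevCharEntire_eq_circleAverage]
  refine Real.circleAverage_mono_on_of_le_circle (circleIntegrable_logPlus_of_entire hf r)
    fun z hz => max_le ?_ (by positivity)
  have : ‖z‖ = r := by simpa [abs_of_nonneg hr] using hz
  rw [← this]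
  exact hD z

lemma exists_integZeroCount_le_mul (hf : Differentiable ℂ f) (h0 : ∃ z, f z ≠ 0) {D : ℝ}
    (hD0 : 0 ≤ D) (hD : ∀ z, Real.log ‖f z‖ ≤ D * (1 + ‖z‖))
    (hN : SmallFn (integZeroCount f) (nevCharEntire f)) {ε : ℝ} (hε : 0 < ε) :
    ∃ R₁ : ℝ, ∀ R, R₁ ≤ R → integZeroCount f R ≤ ε * R := by
  obtain ⟨E, hE, hsmall⟩ := hN
  set L := (volume E).toReal + 1 with hL
  have hL0 : 0 < L := by positivity
  obtain ⟨R₀, hR₀⟩ := hsmall (ε / (3 * (D + 1))) (by positivity)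
  refine ⟨max R₀ (max 1 L), fun R hR => ?_⟩
  simp only [max_le_iff] at hR
  obtain ⟨h1, h2, h3⟩ := hR
  have hex : ∃ r ∈ Set.Icc R (R + L), r ∉ E := by
    by_contra! h
    have h4 : volume (Set.Icc R (R + L)) ≤ volume E := measure_mono h
    rw [Real.volume_Icc, add_sub_cancel_left, ENNReal.ofReal_le_iff_le_toReal hE.ne] at h4
    linarith
  obtain ⟨r, ⟨hr1, hr2⟩, hrE⟩ := hex
  have hT := nevCharEntire_le_linear hf hD0 hD (r := r) (by linarith)
  calc integZeroCount f R ≤ integZeroCount f r := integZeroCount_mono hf h0 h2 hr1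
    _ ≤ ε / (3 * (D + 1)) * nevCharEntire f r :=
        (le_abs_self _).trans (hR₀ r (by linarith) hrE)
    _ ≤ ε / (3 * (D + 1)) * ((D + 1) * (3 * R)) := by
        gcongr
        exact hT.trans (by nlinarith)
    _ = ε * R := by field_simp

lemma exists_zeroCount_le_mul (hf : Differentiable ℂ f) (h0 : ∃ z, f z ≠ 0) {D : ℝ}
    (hD0 : 0 ≤ D) (hD : ∀ z, Real.log ‖f z‖ ≤ D * (1 + ‖z‖))
    (hN : SmallFn (integZeroCount f) (nevCharEntire f)) {ε : ℝ} (hε : 0 < ε) :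
    ∃ R₁ : ℝ, ∀ R, R₁ ≤ R → zeroCount f R ≤ ε * R := by
  have hlog := Real.log_pos one_lt_two
  obtain ⟨R₁, hR₁⟩ := exists_integZeroCount_le_mul hf h0 hD0 hD hN
    (ε := ε * Real.log 2 / 2) (by positivity)
  refine ⟨max 1 R₁, fun R hR => ?_⟩
  obtain ⟨h1, h2⟩ := max_le_iff.mp hR
  have h3 := zeroCount_mul_log_two_le hf h0 h1
  have h4 := hR₁ (2 * R) (by linarith)
  refine le_of_mul_le_mul_right (h3.trans (h4.trans_eq ?_)) hlog
  ring

lemma exists_circleAverage_log_norm_le_mul (hf : Differentiable ℂ f) (h0 : ∃ z, f z ≠ 0) {D : ℝ}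
    (hD0 : 0 ≤ D) (hD : ∀ z, Real.log ‖f z‖ ≤ D * (1 + ‖z‖))
    (hN : SmallFn (integZeroCount f) (nevCharEntire f)) {ε : ℝ} (hε : 0 < ε) :
    ∃ R₁ : ℝ, ∀ R, R₁ ≤ R → Real.circleAverage (fun z => Real.log ‖f z‖) 0 R ≤ ε * R := by
  obtain ⟨K, hK⟩ := exists_circleAverage_log_norm_eq hf h0
  obtain ⟨R₁, hR₁⟩ := exists_integZeroCount_le_mul hf h0 hD0 hD hN (half_pos hε)
  refine ⟨max 1 (max R₁ (2 * |K| / ε)), fun R hR => ?_⟩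
  simp only [max_le_iff, div_le_iff₀ hε] at hR
  rw [hK R (by linarith)]
  linarith [hR₁ R hR.2.1, le_abs_self K]

end FewZeros

section LogDerivative

lemma norm_logDeriv_le_of_norm_le_exp {g : ℂ → ℂ} (hg : Differentiable ℂ g) {M R : ℝ} (hM : 0 < M)
    (hR : 0 < R) (hne : ∀ z, ‖z‖ ≤ R → g z ≠ 0) (hle : ∀ z, ‖z‖ ≤ R → ‖g z‖ ≤ Real.exp M * ‖g 0‖)
    {z : ℂ} (hz : ‖z‖ ≤ R / 2) : ‖logDeriv g z‖ ≤ 24 * M / R := by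
  have hg0 : g 0 ≠ 0 := hne 0 (by simpa using hR.le)
  have hball : ∀ {z : ℂ}, z ∈ ball (0 : ℂ) R → ‖z‖ ≤ R := fun h => (by simpa using h : ‖_‖ < R).le
  obtain ⟨h, h0, hh⟩ := (DifferentiableOn.isExactOn_ball (f := logDeriv g) (c := 0) (r := R)
    (fun z hz => ((hg.deriv z).div (hg z) (hne z (hball hz))).differentiableWithinAt)).with_val_at
      0 0
  have hexp : ∀ z ∈ ball (0 : ℂ) R, g z * Complex.exp (-h z) = g 0 := by
    intro z hz
    have hconst := (isOpen_ball (x := (0 : ℂ)) (ε := R)).is_const_of_deriv_eq_zero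
      (f := fun z => g z * Complex.exp (-h z)) (convex_ball _ _).isPreconnected
      (fun z hz => ((hg z).hasDerivAt.mul (hh z hz).neg.cexp).differentiableAt.differentiableWithinAt)
      (fun z hz => by
        have h1 : HasDerivAt (fun z => g z * Complex.exp (-h z)) _ z :=
          (hg z).hasDerivAt.mul (hh z hz).neg.cexp
        have h2 := hne z (hball hz)
        rw [h1.deriv, logDeriv_apply]
        simp
        field_simp
        ring) hz (mem_ball_self hR)
    simpa [h0] using hconst
  have hre : Set.MapsTo h (ball 0 R) {z | z.re ≤ M} := by
    intro z hz
    have h1 := hle z (hball hz)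
    rw [← hexp z hz, norm_mul, Complex.norm_exp, Complex.neg_re] at h1
    have h2 : 0 < ‖g z‖ := norm_pos_iff.mpr (hne z (hball hz))
    have h3 : 1 ≤ Real.exp (M - (h z).re) := by
      rw [sub_eq_add_neg, Real.exp_add]
      refine le_of_mul_le_mul_right ?_ h2
      linarith
    rw [Real.one_le_exp_iff] at h3
    simpa using h3
  have hd : DifferentiableOn ℂ h (ball 0 R) := fun z hz =>
    (hh z hz).differentiableAt.differentiableWithinAt
  have hsmall : ∀ ζ, ‖ζ‖ ≤ 3 * R / 4 → ‖h ζ‖ ≤ 6 * M := by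
    intro ζ hζ
    have hζ' : ζ ∈ ball (0 : ℂ) R := by simpa using by linarith
    refine (Complex.borelCaratheodory_zero hM hd hre hR hζ' h0).trans ?_
    rw [div_le_iff₀ (by linarith)]
    nlinarith
  have hsub : closedBall z (R / 4) ⊆ ball 0 R := by
    intro ζ hζ
    have h1 : ‖ζ - z‖ ≤ R / 4 := by simpa [dist_eq_norm] using hζ
    have h2 := norm_le_insert' ζ z
    simpa using by linarith
  have hz' : z ∈ ball (0 : ℂ) R := by simpa using by linarith
  have := Complex.norm_deriv_le_of_forall_mem_sphere_norm_le (c := z) (R := R / 4) (C := 6 * M)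
    (f := h) (by positivity) ((hd.mono hsub).diffContOnCl_ball le_rfl) fun ζ hζ => by
      have h1 : ‖ζ - z‖ = R / 4 := by simpa [dist_eq_norm] using hζ
      exact hsmall ζ (by linarith [norm_le_insert' ζ z])
  rw [(hh z hz').deriv] at this
  refine this.trans_eq ?_
  field_simp
  ring

variable {f : ℂ → ℂ}

lemma exists_norm_deriv_le_zeroCount (hf : Differentiable ℂ f) (h0 : ∃ z, f z ≠ 0) {D : ℝ}
    (hD0 : 0 ≤ D) (hD : ∀ z, Real.log ‖f z‖ ≤ D * (1 + ‖z‖)) :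
    ∃ B : ℝ, 0 ≤ B ∧ ∀ R, 1 ≤ R → ∀ z, ‖z‖ ≤ R / 2 → (∀ a, f a = 0 → 1 ≤ ‖z - a‖) →
      ‖deriv f z‖ ≤ (B + zeroCount f R) * ‖f z‖ := by
  obtain ⟨h, hh, hh0, hfh⟩ := exists_factor_zeroMult hf h0 0
  set M₀ : ℝ := 3 * D + |Real.log ‖h 0‖| + 1 with hM₀
  refine ⟨24 * M₀, by positivity, fun R hR z hz hza => ?_⟩
  have hR0 : 0 < R := by linarith
  obtain ⟨g, hg, hgne, hfg⟩ := exists_factor_zerosIn hf h0 R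
  have hn := zeroCount_eq_sum_zerosIn hf h0 R
  have hg0 : ‖h 0‖ ≤ R ^ zeroCount f R * ‖g 0‖ := by
    rw [factor_at_zero_eq hf h0 hR0.le hg hh hfg hfh, norm_mul, norm_prod]
    gcongr
    calc ∏ a ∈ (zerosIn f R).erase 0, ‖(0 - a) ^ zeroMult f a‖
        ≤ ∏ a ∈ (zerosIn f R).erase 0, R ^ zeroMult f a := by
          refine Finset.prod_le_prod (fun _ _ => norm_nonneg _) fun a ha => ?_
          rw [norm_pow, zero_sub, norm_neg]
          have := ((mem_zerosIn hf h0).mp (Finset.mem_of_mem_erase ha)).1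
          gcongr
      _ = R ^ (∑ a ∈ (zerosIn f R).erase 0, zeroMult f a) := Finset.prod_pow_eq_pow_sum _ _ _
      _ ≤ R ^ zeroCount f R := by
          rw [hn]
          exact pow_le_pow_right₀ hR (Finset.sum_le_sum_of_subset (Finset.erase_subset _ _))
  have hsphere : ∀ ζ ∈ sphere (0 : ℂ) (2 * R), ‖g ζ‖ ≤
      Real.exp (D * (1 + 2 * R)) / R ^ zeroCount f R := by
    intro ζ hζ
    have hζ' : ‖ζ‖ = 2 * R := by simpa using hζ
    rw [le_div_iff₀ (by positivity)]
    calc ‖g ζ‖ * R ^ zeroCount f R = R ^ zeroCount f R * ‖g ζ‖ := mul_comm _ _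
      _ ≤ (∏ a ∈ zerosIn f R, ‖(ζ - a) ^ zeroMult f a‖) * ‖g ζ‖ := by
          gcongr
          rw [hn, ← Finset.prod_pow_eq_pow_sum]
          refine Finset.prod_le_prod (fun _ _ => by positivity) fun a ha => ?_
          rw [norm_pow]
          have h1 := ((mem_zerosIn hf h0).mp ha).1
          have h2 := norm_sub_norm_le ζ a
          gcongr
          linarith
      _ = ‖f ζ‖ := by rw [hfg ζ, norm_mul, norm_prod]
      _ ≤ _ := (Real.le_exp_log _).trans (Real.exp_le_exp.mpr (hζ' ▸ hD ζ))
  have hh0' : 0 < ‖h 0‖ := norm_pos_iff.mpr hh0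
  have hgle : ∀ ζ, ‖ζ‖ ≤ R → ‖g ζ‖ ≤ Real.exp (M₀ * R) * ‖g 0‖ := by
    intro ζ hζ
    have h1 := Complex.norm_le_of_forall_mem_frontier_norm_le (U := ball (0 : ℂ) (2 * R))
      isBounded_ball hg.diffContOnCl (fun ξ hξ => hsphere ξ (frontier_ball_subset_sphere hξ))
      (subset_closure (by simpa using by linarith : ζ ∈ ball (0 : ℂ) (2 * R)))
    refine h1.trans ?_
    rw [div_le_iff₀ (by positivity)]
    calc Real.exp (D * (1 + 2 * R)) ≤ Real.exp (M₀ * R + Real.log ‖h 0‖) := by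
          rw [Real.exp_le_exp]
          have := neg_abs_le (Real.log ‖h 0‖)
          have := abs_nonneg (Real.log ‖h 0‖)
          nlinarith
      _ = Real.exp (M₀ * R) * ‖h 0‖ := by rw [Real.exp_add, Real.exp_log hh0']
      _ ≤ Real.exp (M₀ * R) * (R ^ zeroCount f R * ‖g 0‖) := by gcongr
      _ = _ := by ring
  have hlog := norm_logDeriv_le_of_norm_le_exp hg (M := M₀ * R) (by positivity) hR0 hgne hgle hz
  have hzne : ∀ a ∈ zerosIn f R, (z - a) ^ zeroMult f a ≠ 0 := by
    intro a ha
    refine pow_ne_zero _ (norm_ne_zero_iff.mp ?_)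
    linarith [hza a ((mem_zerosIn hf h0).mp ha).2]
  have hfz : f z ≠ 0 := fun h => by
    have := hza z h
    simp at this
    linarith
  have hsum : logDeriv f z = ∑ a ∈ zerosIn f R, zeroMult f a * (1 / (z - a)) + logDeriv g z := by
    have hfun : f = fun z => (∏ a ∈ zerosIn f R, (z - a) ^ zeroMult f a) * g z := funext hfg
    conv_lhs => rw [hfun]
    rw [logDeriv_mul z (Finset.prod_ne_zero_iff.mpr hzne) (hgne z (by linarith)) (by fun_prop)
      (hg z), logDeriv_prod hzne (fun _ _ => by fun_prop)]
    congr 1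
    refine Finset.sum_congr rfl fun a ha => ?_
    rw [logDeriv_fun_pow (f := fun z => z - a) (by fun_prop), logDeriv_apply]
    simp
  have hderiv : deriv f z = logDeriv f z * f z := by
    rw [logDeriv_apply, div_mul_cancel₀ _ hfz]
  rw [hderiv, norm_mul]
  gcongr
  rw [hsum]
  refine (norm_add_le _ _).trans ?_
  rw [add_comm]
  refine add_le_add (hlog.trans_eq (by field_simp)) ((norm_sum_le _ _).trans ?_)
  rw [hn, Nat.cast_sum]
  refine Finset.sum_le_sum fun a ha => ?_
  rw [norm_mul, norm_div, norm_one, Complex.norm_natCast]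
  refine mul_le_of_le_one_right (Nat.cast_nonneg _) ?_
  have := hza a ((mem_zerosIn hf h0).mp ha).2
  rw [div_le_one (by linarith)]
  exact this

end LogDerivative

section ZeroFreeAnnulus

variable {f : ℂ → ℂ}

lemma card_zerosIn_le_zeroCount (hf : Differentiable ℂ f) (h0 : ∃ z, f z ≠ 0) (R : ℝ) :
    (zerosIn f R).card ≤ zeroCount f R := by
  rw [zeroCount_eq_sum_zerosIn hf h0, Finset.card_eq_sum_ones]
  refine Finset.sum_le_sum fun a ha => Nat.one_le_iff_ne_zero.mpr fun h => ?_
  exact (zeroMult_eq_zero_iff hf h0 a).mp h ((mem_zerosIn hf h0).mp ha).2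

lemma exists_zero_free_annulus (hf : Differentiable ℂ f) (h0 : ∃ z, f z ≠ 0)
    (hcount : ∀ ε : ℝ, 0 < ε → ∃ R₁ : ℝ, ∀ R, R₁ ≤ R → zeroCount f R ≤ ε * R)
    {K : ℝ} (hK : 0 < K) (R₀ : ℝ) :
    ∃ R r : ℝ, R₀ ≤ R ∧ R / 4 ≤ r ∧ r + K ≤ R / 2 ∧ ∀ a, f a = 0 → K ≤ |‖a‖ - r| := by
  obtain ⟨R₁, hR₁⟩ := hcount (1 / (16 * K)) (by positivity)
  obtain ⟨m, hm⟩ := exists_nat_ge (max (R₀ / (8 * K)) (max (R₁ / (8 * K)) 1))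
  simp only [max_le_iff, div_le_iff₀ (by positivity : 0 < 8 * K)] at hm
  obtain ⟨hm0, hm1, hm2⟩ := hm
  set R : ℝ := m * (8 * K) with hR
  have hcard : ((zerosIn f R).card : ℝ) < m := by
    have h1 := hR₁ R hm1
    have h2 : ((zerosIn f R).card : ℝ) ≤ zeroCount f R :=
      Nat.cast_le.mpr (card_zerosIn_le_zeroCount hf h0 R)
    have h3 : 1 / (16 * K) * R = m / 2 := by
      rw [hR]
      field_simp
      norm_num
    linarith
  by_contra! hcon
  have hex : ∀ i ∈ Finset.range m, ∃ a, f a = 0 ∧ |‖a‖ - (R / 4 + K * (2 * i + 1))| < K := by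
    intro i hi
    have him : (i : ℝ) + 1 ≤ m := by exact_mod_cast Finset.mem_range.mp hi
    refine hcon R _ hm0 ?_ ?_
    · have : 0 ≤ K * (2 * i + 1) := by positivity
      linarith
    · rw [hR]
      nlinarith
  choose! a ha0 ha using hex
  have hmaps : Set.MapsTo a (Finset.range m) (zerosIn f R) := by
    intro i hi
    refine (mem_zerosIn hf h0).mpr ⟨?_, ha0 i hi⟩
    have him : (i : ℝ) + 1 ≤ m := by exact_mod_cast Finset.mem_range.mp hi
    have := (abs_lt.mp (ha i hi)).2
    have : 0 ≤ (m : ℝ) * K := by positivity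
    nlinarith
  have hinj : Set.InjOn a (Finset.range m) := by
    intro i hi j hj hij
    have h1 := abs_lt.mp (ha i hi)
    have h2 := abs_lt.mp (ha j hj)
    rw [hij] at h1
    have h3 : (i : ℝ) < j + 1 := by
      by_contra! h
      nlinarith
    have h4 : (j : ℝ) < i + 1 := by
      by_contra! h
      nlinarith
    norm_cast at h3 h4
    omega
  have := Finset.card_le_card_of_injOn a hmaps hinj
  rw [Finset.card_range] at this
  have : (m : ℝ) ≤ (zerosIn f R).card := by exact_mod_cast this
  linarith

lemma norm_add_le_exp_mul_of_norm_deriv_le (hf : Differentiable ℂ f) {z : ℂ} {L ρ : ℝ}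
    (hder : ∀ ζ, ‖ζ - z‖ ≤ ρ → ‖deriv f ζ‖ ≤ L * ‖f ζ‖) {t : ℂ} (ht : ‖t‖ ≤ ρ) :
    ‖f (z + t)‖ ≤ Real.exp (L * ρ) * ‖f z‖ := by
  have hd : ∀ x : ℝ, HasDerivAt (fun x : ℝ => f (z + x * t)) (t * deriv f (z + x * t)) x := by
    intro x
    have h1 : HasDerivAt (fun x : ℝ => z + x * t) t x := by
      simpa using ((Complex.ofRealCLM.hasDerivAt (x := x)).mul_const t).const_add z
    have h2 := HasDerivAt.scomp x (hf (z + x * t)).hasDerivAt h1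
    exact h2
  have := norm_le_gronwallBound_of_norm_deriv_right_le (f := fun x : ℝ => f (z + x * t))
    (f' := fun x : ℝ => t * deriv f (z + x * t)) (δ := ‖f z‖) (K := L * ρ) (ε := 0) (a := 0)
    (b := 1) (fun x _ => (hd x).continuousAt.continuousWithinAt)
    (fun x _ => (hd x).hasDerivWithinAt) (by simp) (fun x hx => by
      have h1 : ‖z + x * t - z‖ ≤ ρ := by
        rw [add_sub_cancel_left, norm_mul, Complex.norm_real, Real.norm_of_nonneg hx.1]
        nlinarith [norm_nonneg t, hx.2, hx.1]
      rw [norm_mul, add_zero, mul_comm L, mul_assoc]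
      have h2 := hder _ h1
      have h3 : 0 ≤ ρ := (norm_nonneg t).trans ht
      gcongr) 1 (by simp)
  rw [gronwallBound_ε0] at this
  simpa [mul_comm] using this

/-- There are arbitrarily large circles, free of zeros, near which `f` varies slowly. -/
lemma exists_circle_norm_add_le (hf : Differentiable ℂ f) (h0 : ∃ z, f z ≠ 0) {D : ℝ}
    (hD0 : 0 ≤ D) (hD : ∀ z, Real.log ‖f z‖ ≤ D * (1 + ‖z‖))
    (hcount : ∀ ε : ℝ, 0 < ε → ∃ R₁ : ℝ, ∀ R, R₁ ≤ R → zeroCount f R ≤ ε * R)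
    {ρ ε : ℝ} (hρ : 0 ≤ ρ) (hε : 0 < ε) (r₀ : ℝ) :
    ∃ r, r₀ ≤ r ∧ ∀ z, ‖z‖ = r → f z ≠ 0 ∧
      ∀ t, ‖t‖ ≤ ρ → ‖f (z + t)‖ ≤ Real.exp (ε * r) * ‖f z‖ := by
  obtain ⟨B, hB0, hB⟩ := exists_norm_deriv_le_zeroCount hf h0 hD0 hD
  set η : ℝ := ε / (8 * (ρ + 1)) with hη
  have hη0 : 0 < η := by positivity
  obtain ⟨R₁, hR₁⟩ := hcount η hη0
  obtain ⟨R, r, hR, hr1, hr2, hr⟩ := exists_zero_free_annulus hf h0 hcount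
    (K := ρ + 1) (by positivity) (max (4 * r₀) (max R₁ (max 1 (B / η))))
  simp only [max_le_iff, div_le_iff₀ hη0] at hR
  obtain ⟨hR2, hR3, hR4, hR5⟩ := hR
  refine ⟨r, by linarith, fun z hz => ?_⟩
  have hdist : ∀ ζ, ‖ζ - z‖ ≤ ρ → ∀ a, f a = 0 → 1 ≤ ‖ζ - a‖ := by
    intro ζ hζ a ha
    have h1 := hr a ha
    have h2 := abs_norm_sub_norm_le a z
    have h3 : ‖a - z‖ ≤ ‖ζ - z‖ + ‖ζ - a‖ := by
      rw [← norm_neg (ζ - a), show a - z = (ζ - z) + -(ζ - a) by ring]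
      exact norm_add_le _ _
    rw [hz] at h2
    linarith
  refine ⟨fun h => ?_, fun t ht => ?_⟩
  · have := hdist z (by simpa using hρ) z h
    simp at this
    linarith
  · refine (norm_add_le_exp_mul_of_norm_deriv_le hf (z := z) (L := B + zeroCount f R) (ρ := ρ)
      (fun ζ hζ => hB R hR4 ζ ?_ (hdist ζ hζ)) ht).trans ?_
    · linarith [norm_le_insert' ζ z]
    · refine mul_le_mul_of_nonneg_right (Real.exp_le_exp.mpr ?_) (norm_nonneg _)
      have h1 := hR₁ R hR3
      calc (B + zeroCount f R) * ρ ≤ (2 * (η * R)) * (ρ + 1) := by gcongr <;> linarith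
        _ = ε * (R / 4) := by rw [hη]; field_simp; norm_num
        _ ≤ ε * r := by gcongr

end ZeroFreeAnnulus

section Annihilator

/-- The operator `u ↦ u'' - (α₁ + α₂) u' + α₁ α₂ u`, which annihilates `exp (α₁ z)` and
`exp (α₂ z)`. -/
def expAnnihilator (α₁ α₂ : ℂ) (u : ℂ → ℂ) (z : ℂ) : ℂ :=
  deriv (deriv u) z - (α₁ + α₂) * deriv u z + α₁ * α₂ * u z

variable {α₁ α₂ : ℂ} {u v : ℂ → ℂ}

lemma differentiable_expAnnihilator (hu : Differentiable ℂ u) :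
    Differentiable ℂ (expAnnihilator α₁ α₂ u) := by
  have h1 := hu.deriv
  have h2 := h1.deriv
  unfold expAnnihilator
  fun_prop

lemma deriv_exp_mul (α : ℂ) : deriv (fun z => Complex.exp (α * z)) =
    fun z => α * Complex.exp (α * z) := by
  funext z
  have : HasDerivAt (fun z => Complex.exp (α * z)) (Complex.exp (α * z) * α) z := by
    simpa using ((hasDerivAt_id z).const_mul α).cexp
  rw [this.deriv, mul_comm]

lemma deriv_exp_sum (p₁ p₂ : ℂ) :
    deriv (fun z => p₁ * Complex.exp (α₁ * z) + p₂ * Complex.exp (α₂ * z)) =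
      fun z => (p₁ * α₁) * Complex.exp (α₁ * z) + (p₂ * α₂) * Complex.exp (α₂ * z) := by
  funext z
  rw [deriv_fun_add (by fun_prop) (by fun_prop), deriv_const_mul_field, deriv_const_mul_field,
    deriv_exp_mul, deriv_exp_mul]
  ring

lemma expAnnihilator_exp_sum (p₁ p₂ z : ℂ) :
    expAnnihilator α₁ α₂ (fun z => p₁ * Complex.exp (α₁ * z) + p₂ * Complex.exp (α₂ * z)) z
      = 0 := by
  rw [expAnnihilator, deriv_exp_sum, deriv_exp_sum]
  ring

lemma expAnnihilator_add (hu : Differentiable ℂ u) (hv : Differentiable ℂ v) (z : ℂ) :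
    expAnnihilator α₁ α₂ (fun z => u z + v z) z =
      expAnnihilator α₁ α₂ u z + expAnnihilator α₁ α₂ v z := by
  have h1 : deriv (fun z => u z + v z) = fun z => deriv u z + deriv v z :=
    funext fun z => deriv_fun_add (hu z) (hv z)
  rw [expAnnihilator, h1, deriv_fun_add (hu.deriv z) (hv.deriv z), expAnnihilator, expAnnihilator]
  ring

lemma norm_expAnnihilator_le (hu : Differentiable ℂ u) {z : ℂ} {B : ℝ}
    (hB : ∀ t : ℂ, ‖t‖ ≤ 1 → ‖u (z + t)‖ ≤ B) :
    ‖expAnnihilator α₁ α₂ u z‖ ≤ (2 + ‖α₁ + α₂‖ + ‖α₁ * α₂‖) * B := by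
  have h2 := norm_iteratedDeriv_le_of_forall_closedBall hu 2 z hB
  have h1 := norm_iteratedDeriv_le_of_forall_closedBall hu 1 z hB
  have h0 := hB 0 (by simp)
  rw [add_zero] at h0
  rw [iteratedDeriv_succ, iteratedDeriv_one] at h2
  rw [iteratedDeriv_one] at h1
  rw [Nat.factorial_one, Nat.cast_one, one_mul] at h1
  rw [Nat.factorial_two, Nat.cast_ofNat] at h2
  rw [expAnnihilator]
  refine (norm_add_le _ _).trans ?_
  have h3 := norm_sub_le (deriv (deriv u) z) ((α₁ + α₂) * deriv u z)
  rw [norm_mul] at h3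
  rw [norm_mul (α₁ * α₂)]
  have h4 : ‖α₁ + α₂‖ * ‖deriv u z‖ ≤ ‖α₁ + α₂‖ * B := by gcongr
  have h5 : ‖α₁ * α₂‖ * ‖u z‖ ≤ ‖α₁ * α₂‖ * B := by gcongr
  linarith

end Annihilator

section SmallCharacteristic

variable {f : ℂ → ℂ}

lemma log_norm_le_of_norm_le_min {x y B δ : ℝ} (hx : 0 < x) (hy : 0 < y) (hB : 0 < B)
    (h₁ : y ≤ B * Real.exp δ * x) (h₃ : y ≤ B * Real.exp δ * x ^ 3) :
    Real.log y ≤ 3 * Real.log x + (-2 * logPlus x + (Real.log B + δ)) := by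
  have e1 := Real.log_le_log hy h₁
  have e3 := Real.log_le_log hy h₃
  rw [Real.log_mul (by positivity) (by positivity), Real.log_mul hB.ne' (by positivity),
    Real.log_exp] at e1 e3
  rw [Real.log_pow] at e3
  push_cast at e3
  unfold logPlus
  rcases le_total (Real.log x) 0 with h | h
  · rw [max_eq_right h]; linarith
  · rw [max_eq_left h]; linarith

/-- If `W` is entire, not identically zero and dominated by both `f` and `f³` on large circles,
then `f` has small characteristic on those circles. -/
lemma exists_nevCharEntire_le_mul {W : ℂ → ℂ} (hf : Differentiable ℂ f) (hW : Differentiable ℂ W)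
    (hW0 : ∃ z, W z ≠ 0)
    (havg : ∀ ε : ℝ, 0 < ε → ∃ R₁ : ℝ, ∀ R, R₁ ≤ R →
      Real.circleAverage (fun z => Real.log ‖f z‖) 0 R ≤ ε * R) {B : ℝ} (hB : 0 < B)
    (hle : ∀ ε : ℝ, 0 < ε → ∀ r₀ : ℝ, ∃ r, r₀ ≤ r ∧ ∀ z, ‖z‖ = r → f z ≠ 0 ∧
      ‖W z‖ ≤ B * Real.exp (ε * r) * ‖f z‖ ∧ ‖W z‖ ≤ B * Real.exp (ε * r) * ‖f z‖ ^ 3)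
    {ε : ℝ} (hε : 0 < ε) (r₀ : ℝ) : ∃ r, r₀ ≤ r ∧ nevCharEntire f r ≤ ε * r := by
  obtain ⟨K, hK⟩ := exists_circleAverage_log_norm_eq hW hW0
  set η := ε / 6 with hη
  have hη0 : 0 < η := by positivity
  obtain ⟨R₁, hR₁⟩ := havg η hη0
  obtain ⟨r, hr, h⟩ := hle η hη0 (max r₀ (max R₁ (max 1 ((Real.log B - K) / η))))
  simp only [max_le_iff, div_le_iff₀ hη0] at hr
  obtain ⟨hr0, hr1, hr2, hr3⟩ := hr
  have hrpos : 0 < r := by linarith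
  refine ⟨r, hr0, ?_⟩
  have i1 := (circleIntegrable_log_norm_of_entire hf r).const_fun_smul (a := (3:ℝ))
  have i2 := (circleIntegrable_logPlus_of_entire hf r).const_fun_smul (a := (-2:ℝ))
  have i3 : CircleIntegrable (fun _ : ℂ => Real.log B + η * r) 0 r := circleIntegrable_const _ _ _
  have hmono := circleAverage_mono_off_countable hrpos.ne' (s := (zerosIn W r : Set ℂ))
    (Finset.countable_toSet _) (circleIntegrable_log_norm_of_entire hW r) (i1.add (i2.add i3))
    fun z hz hzs => by
      rw [abs_of_pos hrpos] at hz
      have hz' : ‖z‖ = r := by simpa using hz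
      obtain ⟨hz1, hz2, hz3⟩ := h z hz'
      have hWz : W z ≠ 0 := fun h => hzs ((mem_zerosIn hW hW0).mpr ⟨hz'.le, h⟩)
      exact log_norm_le_of_norm_le_min (norm_pos_iff.mpr hz1) (norm_pos_iff.mpr hWz) hB hz2 hz3
  rw [Real.circleAverage_add i1 (i2.add i3), Real.circleAverage_add i2 i3,
    Real.circleAverage_const, Real.circleAverage_fun_smul, Real.circleAverage_fun_smul,
    hK r hrpos, ← nevCharEntire_eq_circleAverage, smul_eq_mul, smul_eq_mul] at hmono
  have := integZeroCount_nonneg hW hW0 hr2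
  have := hR₁ r hr1
  have : ε * r = 6 * (η * r) := by rw [hη]; ring
  have : 0 < η * r := by positivity
  linarith

end SmallCharacteristic

section Growth

lemma re_mul_conj_lt {α β : ℂ} (hne : α ≠ β) (hle : ‖β‖ ≤ ‖α‖) :
    (β * (starRingEnd ℂ) α).re < ‖α‖ ^ 2 := by
  have h1 : 0 < Complex.normSq (α - β) := Complex.normSq_pos.mpr (sub_ne_zero.mpr hne)
  rw [Complex.normSq_sub, Complex.normSq_eq_norm_sq, Complex.normSq_eq_norm_sq] at h1
  have h2 : (α * (starRingEnd ℂ) β).re = (β * (starRingEnd ℂ) α).re := by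
    simp [Complex.mul_re]
    ring
  have h3 : ‖β‖ ^ 2 ≤ ‖α‖ ^ 2 := by gcongr
  linarith

lemma exists_exp_sum_gt_of_norm_le {p q α β : ℂ} (hp : p ≠ 0) (hα : α ≠ 0) (hne : α ≠ β)
    (hle : ‖β‖ ≤ ‖α‖) (B : ℝ) :
    ∃ t₀ : ℝ, ∀ t, t₀ ≤ t → ∃ z : ℂ, ‖z‖ ≤ t ∧
      B * Real.exp (‖α‖ / 2 * t) < ‖p * Complex.exp (α * z) + q * Complex.exp (β * z)‖ := by
  have hα' : 0 < ‖α‖ := norm_pos_iff.mpr hα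
  set b : ℝ := (β * (starRingEnd ℂ) α).re / ‖α‖ with hb
  have hblt : b < ‖α‖ := by
    rw [hb, div_lt_iff₀ hα', ← sq]
    exact re_mul_conj_lt hne hle
  have hlim : ∀ s : ℝ, s < 0 → Tendsto (fun t : ℝ => Real.exp (s * t)) atTop (nhds 0) := fun s hs =>
    Real.tendsto_exp_atBot.comp (tendsto_id.const_mul_atTop_of_neg hs)
  have h1 := ((hlim (b - ‖α‖) (by linarith)).const_mul ‖q‖).add
    ((hlim (-(‖α‖ / 2)) (by linarith)).const_mul B)
  simp only [mul_zero, add_zero] at h1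
  obtain ⟨t₁, ht₁⟩ := Filter.eventually_atTop.mp (h1.eventually_lt_const (norm_pos_iff.mpr hp))
  refine ⟨max t₁ 0, fun t ht => ?_⟩
  obtain ⟨ht1, ht0⟩ := max_le_iff.mp ht
  have h2 := ht₁ t ht1
  refine ⟨(t / ‖α‖ : ℝ) * (starRingEnd ℂ) α, ?_, ?_⟩
  · rw [norm_mul, Complex.norm_real, RCLike.norm_conj, Real.norm_of_nonneg (by positivity),
      div_mul_cancel₀ _ hα'.ne']
  · have e1 : ‖Complex.exp (α * ((t / ‖α‖ : ℝ) * (starRingEnd ℂ) α))‖ = Real.exp (‖α‖ * t) := by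
      rw [Complex.norm_exp, mul_left_comm, Complex.re_ofReal_mul, Complex.mul_conj,
        Complex.ofReal_re, Complex.normSq_eq_norm_sq]
      congr 1
      field_simp
    have e2 : ‖Complex.exp (β * ((t / ‖α‖ : ℝ) * (starRingEnd ℂ) α))‖ = Real.exp (b * t) := by
      rw [Complex.norm_exp, mul_left_comm, Complex.re_ofReal_mul, hb]
      congr 1
      field_simp
    have h3 := norm_sub_le_norm_add (p * Complex.exp (α * ((t / ‖α‖ : ℝ) * (starRingEnd ℂ) α)))
      (q * Complex.exp (β * ((t / ‖α‖ : ℝ) * (starRingEnd ℂ) α)))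
    rw [norm_mul, norm_mul, e1, e2] at h3
    refine lt_of_lt_of_le ?_ h3
    have h4 : 0 < Real.exp (‖α‖ * t) := Real.exp_pos _
    have h5 := mul_lt_mul_of_pos_right h2 h4
    rw [add_mul, mul_assoc, mul_assoc, ← Real.exp_add, ← Real.exp_add] at h5
    ring_nf at h5 ⊢
    linarith

lemma exists_exp_sum_gt {p₁ p₂ α₁ α₂ : ℂ} (hp₁ : p₁ ≠ 0) (hp₂ : p₂ ≠ 0) (hα₁ : α₁ ≠ 0)
    (hα₂ : α₂ ≠ 0) (hα : α₁ ≠ α₂) :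
    ∃ σ : ℝ, 0 < σ ∧ ∀ B : ℝ, ∃ t₀ : ℝ, ∀ t, t₀ ≤ t → ∃ z : ℂ, ‖z‖ ≤ t ∧
      B * Real.exp (σ * t) < ‖p₁ * Complex.exp (α₁ * z) + p₂ * Complex.exp (α₂ * z)‖ := by
  rcases le_total ‖α₂‖ ‖α₁‖ with h | h
  · exact ⟨‖α₁‖ / 2, by positivity, exists_exp_sum_gt_of_norm_le hp₁ hα₁ hα h⟩
  · refine ⟨‖α₂‖ / 2, by positivity, fun B => ?_⟩
    simp only [add_comm (p₁ * _)]
    exact exists_exp_sum_gt_of_norm_le hp₂ hα₂ hα.symm h B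

end Growth

section Equation

variable {f : ℂ → ℂ} {k : ℕ} {c w p₁ p₂ α₁ α₂ : ℂ}

lemma Differentiable.iteratedDeriv_complex (hf : Differentiable ℂ f) (k : ℕ) :
    Differentiable ℂ (iteratedDeriv k f) :=
  hf.contDiff.differentiable_iteratedDeriv k (WithTop.coe_lt_top _)

lemma not_small_nevCharEntire (hf : Differentiable ℂ f) (h0 : ∃ z, f z ≠ 0)
    (hp₁ : p₁ ≠ 0) (hp₂ : p₂ ≠ 0) (hα₁ : α₁ ≠ 0) (hα₂ : α₂ ≠ 0) (hα : α₁ ≠ α₂)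
    (heq : ∀ z : ℂ, f z ^ 3 + w * f z ^ 2 * deriv f z + iteratedDeriv k f (z + c)
      = p₁ * Complex.exp (α₁ * z) + p₂ * Complex.exp (α₂ * z))
    (hcount : ∀ ε : ℝ, 0 < ε → ∃ R₁ : ℝ, ∀ R, R₁ ≤ R → zeroCount f R ≤ ε * R) :
    ∃ ε : ℝ, 0 < ε ∧ ∃ r₀ : ℝ, ∀ r, r₀ ≤ r → ε * r < nevCharEntire f r := by
  obtain ⟨σ, hσ, hgt⟩ := exists_exp_sum_gt hp₁ hp₂ hα₁ hα₂ hα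
  obtain ⟨t₀, ht₀⟩ := hgt (1 + ‖w‖ + k.factorial)
  set ε : ℝ := σ / 72 with hε
  have hε0 : 0 < ε := by positivity
  obtain ⟨R₁, hR₁⟩ := hcount ε hε0
  refine ⟨ε, hε0, max (4 * t₀) (max R₁ (4 * (‖c‖ + 1))), fun r hr => ?_⟩
  simp only [max_le_iff] at hr
  obtain ⟨hr0, hr1, hr2⟩ := hr
  have hc := norm_nonneg c
  by_contra! hT
  obtain ⟨z, hz, hz2⟩ := ht₀ (r / 4) (by linarith)
  have hfle : ∀ ζ, ‖ζ‖ ≤ r / 2 → ‖f ζ‖ ≤ Real.exp (6 * ε * r) := by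
    intro ζ hζ
    refine (Real.le_exp_log _).trans (Real.exp_le_exp.mpr ?_)
    refine (log_norm_le_nevCharEntire_add hf h0 (by linarith) hζ).trans ?_
    have h1 : zeroCount f r * Real.log 2 ≤ zeroCount f r * 1 := by
      gcongr
      linarith [Real.log_two_lt_d9]
    linarith [hR₁ r hr1]
  have hfz := hfle z (by linarith)
  have hdz : ‖deriv f z‖ ≤ Real.exp (6 * ε * r) := by
    have := norm_iteratedDeriv_le_of_forall_closedBall hf 1 z (B := Real.exp (6 * ε * r))
      fun t ht => hfle _ (by linarith [norm_add_le z t])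
    simpa using this
  have hVz := norm_iteratedDeriv_le_of_forall_closedBall hf k (z + c) (B := Real.exp (6 * ε * r))
      fun t ht => hfle _ (by linarith [norm_add_le (z + c) t, norm_add_le z c])
  rw [← heq z] at hz2
  refine absurd hz2 (not_lt.mpr ?_)
  set e := Real.exp (6 * ε * r) with he
  have hee : e ^ 3 = Real.exp (σ * (r / 4)) := by
    rw [he, ← Real.exp_nat_mul, hε]
    congr 1
    push_cast
    ring
  have hrpos : 0 ≤ r := by linarith
  have he1 : 1 ≤ e := Real.one_le_exp (by positivity)
  rw [← hee]
  calc _ ≤ ‖f z‖ ^ 3 + ‖w‖ * ‖f z‖ ^ 2 * ‖deriv f z‖ + ‖iteratedDeriv k f (z + c)‖ := by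
        refine (norm_add₃_le).trans_eq ?_
        simp only [norm_mul, norm_pow]
    _ ≤ e ^ 3 + ‖w‖ * e ^ 2 * e + k.factorial * e ^ 3 := by
        gcongr
        exact hVz.trans (by gcongr; exact le_self_pow₀ he1 (by norm_num))
    _ = _ := by ring

/-- The nonlinear part of the equation is annihilated by `expAnnihilator`. -/
lemma expAnnihilator_eq_zero (hf : Differentiable ℂ f) (h0 : ∃ z, f z ≠ 0) {D : ℝ}
    (hD0 : 0 ≤ D) (hD : ∀ z, Real.log ‖f z‖ ≤ D * (1 + ‖z‖))
    (hp₁ : p₁ ≠ 0) (hp₂ : p₂ ≠ 0) (hα₁ : α₁ ≠ 0) (hα₂ : α₂ ≠ 0) (hα : α₁ ≠ α₂)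
    (heq : ∀ z : ℂ, f z ^ 3 + w * f z ^ 2 * deriv f z + iteratedDeriv k f (z + c)
      = p₁ * Complex.exp (α₁ * z) + p₂ * Complex.exp (α₂ * z))
    (hN : SmallFn (integZeroCount f) (nevCharEntire f)) (z : ℂ) :
    expAnnihilator α₁ α₂ (fun z => f z ^ 3 + w * f z ^ 2 * deriv f z) z = 0 := by
  have hf' := hf.deriv
  have hG : Differentiable ℂ (fun z => f z ^ 3 + w * f z ^ 2 * deriv f z) := by fun_prop
  have hV : Differentiable ℂ (fun z => iteratedDeriv k f (z + c)) :=
    (hf.iteratedDeriv_complex k).comp (differentiable_id.add_const c)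
  have hsum : ∀ z, expAnnihilator α₁ α₂ (fun z => f z ^ 3 + w * f z ^ 2 * deriv f z) z
      + expAnnihilator α₁ α₂ (fun z => iteratedDeriv k f (z + c)) z = 0 := by
    intro z
    rw [← expAnnihilator_add hG hV, funext heq, expAnnihilator_exp_sum]
  by_contra hne
  have hcount : ∀ ε : ℝ, 0 < ε → ∃ R₁ : ℝ, ∀ R, R₁ ≤ R → zeroCount f R ≤ ε * R := fun ε hε =>
    exists_zeroCount_le_mul hf h0 hD0 hD hN hε
  obtain ⟨ε₁, hε₁, r₁, hr₁⟩ := not_small_nevCharEntire hf h0 hp₁ hp₂ hα₁ hα₂ hα heq hcount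
  set Q : ℝ := 2 + ‖α₁ + α₂‖ + ‖α₁ * α₂‖ with hQ
  have hQ0 : 0 < Q := by positivity
  have hle : ∀ ε : ℝ, 0 < ε → ∀ r₀ : ℝ, ∃ r, r₀ ≤ r ∧ ∀ z, ‖z‖ = r → f z ≠ 0 ∧
      ‖expAnnihilator α₁ α₂ (fun z => f z ^ 3 + w * f z ^ 2 * deriv f z) z‖ ≤
        (Q * (1 + ‖w‖ + k.factorial)) * Real.exp (ε * r) * ‖f z‖ ∧
      ‖expAnnihilator α₁ α₂ (fun z => f z ^ 3 + w * f z ^ 2 * deriv f z) z‖ ≤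
        (Q * (1 + ‖w‖ + k.factorial)) * Real.exp (ε * r) * ‖f z‖ ^ 3 := by
    intro ε hε r₀
    obtain ⟨r, hr, h⟩ := exists_circle_norm_add_le hf h0 hD0 hD hcount (ρ := ‖c‖ + 2)
      (ε := ε / 3) (by positivity) (by positivity) (max r₀ 0)
    obtain ⟨hr0, hr0'⟩ := max_le_iff.mp hr
    refine ⟨r, hr0, fun z hz => ?_⟩
    obtain ⟨hfz, hslow⟩ := h z hz
    have hc := norm_nonneg c
    set e := Real.exp (ε / 3 * r) with he
    have he3 : Real.exp (ε * r) = e ^ 3 := by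
      rw [he, ← Real.exp_nat_mul]
      congr 1
      push_cast
      ring
    have he1 : 1 ≤ e := Real.one_le_exp (by positivity)
    have hee : e ≤ e ^ 3 := le_self_pow₀ he1 (by norm_num)
    refine ⟨hfz, ?_, ?_⟩
    · rw [eq_neg_of_add_eq_zero_left (hsum z), norm_neg, he3]
      refine (norm_expAnnihilator_le hV (B := k.factorial * (e * ‖f z‖)) fun t ht => ?_).trans ?_
      · refine norm_iteratedDeriv_le_of_forall_closedBall hf k _ fun s hs => ?_
        rw [show z + t + c + s = z + (t + c + s) by ring]
        exact hslow _ (by linarith [norm_add_le (t + c) s, norm_add_le t c])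
      · rw [mul_assoc Q, mul_assoc Q, mul_assoc _ _ ‖f z‖]
        exact mul_le_mul_of_nonneg_left (mul_le_mul (by linarith [norm_nonneg w]) (by gcongr)
          (by positivity) (by positivity)) hQ0.le
    · rw [he3]
      refine (norm_expAnnihilator_le hG (B := (1 + ‖w‖) * (e * ‖f z‖) ^ 3) fun t ht => ?_).trans ?_
      · have h1 := hslow t (by linarith)
        have h2 : ‖deriv f (z + t)‖ ≤ e * ‖f z‖ := by
          have := norm_iteratedDeriv_le_of_forall_closedBall hf 1 (z + t) (B := e * ‖f z‖)
            fun s hs => by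
              rw [add_assoc]
              exact hslow _ (by linarith [norm_add_le t s])
          simpa using this
        refine (norm_add_le _ _).trans ?_
        rw [norm_mul, norm_mul, norm_pow, norm_pow]
        calc _ ≤ (e * ‖f z‖) ^ 3 + ‖w‖ * (e * ‖f z‖) ^ 2 * (e * ‖f z‖) := by gcongr
          _ = _ := by ring
      · rw [mul_pow, mul_assoc Q, mul_assoc Q, mul_assoc _ _ (‖f z‖ ^ 3)]
        refine mul_le_mul_of_nonneg_left (mul_le_mul_of_nonneg_right ?_ (by positivity)) hQ0.le
        linarith [(Nat.cast_nonneg k.factorial : (0 : ℝ) ≤ k.factorial)]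
  obtain ⟨r, hr, hT⟩ := exists_nevCharEntire_le_mul hf (differentiable_expAnnihilator hG) ⟨z, hne⟩
    (fun ε hε => exists_circleAverage_log_norm_le_mul hf h0 hD0 hD hN hε) (by positivity) hle
    hε₁ r₁
  exact absurd hT (not_le.mpr (hr₁ r hr))

end Equation

section ExponentialForm

variable {f u : ℂ → ℂ} {k : ℕ} {c w p₁ p₂ α α₁ α₂ : ℂ}

lemma eq_mul_exp_of_deriv_eq (hu : Differentiable ℂ u) (h : ∀ z, deriv u z = α * u z) (z : ℂ) :
    u z = u 0 * Complex.exp (α * z) := by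
  have hd : ∀ z, HasDerivAt (fun z => u z * Complex.exp (-(α * z))) 0 z := by
    intro z
    have h1 := ((hasDerivAt_id z).const_mul α).neg.cexp
    refine ((hu z).hasDerivAt.mul h1).congr_deriv ?_
    rw [h z]
    simp only [id]
    ring
  have := is_const_of_deriv_eq_zero (fun z => (hd z).differentiableAt) (fun z => (hd z).deriv) z 0
  simp only [mul_zero, neg_zero, Complex.exp_zero, mul_one] at this
  rw [← this, mul_assoc, ← Complex.exp_add, neg_add_cancel, Complex.exp_zero, mul_one]

lemma eq_zero_of_deriv_eq (hu : Differentiable ℂ u) (h : ∀ z, deriv u z = α * u z) {z₀ : ℂ}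
    (h0 : u z₀ = 0) (z : ℂ) : u z = 0 := by
  have h1 := eq_mul_exp_of_deriv_eq hu h z₀
  rw [h0, eq_comm, mul_eq_zero, or_iff_left (Complex.exp_ne_zero _)] at h1
  rw [eq_mul_exp_of_deriv_eq hu h z, h1, zero_mul]

/-- Uniqueness for the second order equation `expAnnihilator α₁ α₂ u = 0`. -/
lemma eq_zero_of_expAnnihilator_eq_zero (hu : Differentiable ℂ u) (hα : α₁ ≠ α₂)
    (h : ∀ z, expAnnihilator α₁ α₂ u z = 0) {z₀ : ℂ} (h0 : u z₀ = 0) (h1 : deriv u z₀ = 0)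
    (z : ℂ) : u z = 0 := by
  have key : ∀ β γ : ℂ, (∀ z, deriv (deriv u) z = (γ + β) * deriv u z - γ * β * u z) →
      deriv u z = γ * u z := by
    intro β γ hβ
    have hd : ∀ z, HasDerivAt (fun z => deriv u z - γ * u z)
        (deriv (deriv u) z - γ * deriv u z) z := fun z =>
      (hu.deriv z).hasDerivAt.sub ((hu z).hasDerivAt.const_mul γ)
    have := eq_zero_of_deriv_eq (u := fun z => deriv u z - γ * u z) (α := β)
      (fun z => (hd z).differentiableAt)
      (fun z => by rw [(hd z).deriv, hβ]; ring) (z₀ := z₀) (by simp [h0, h1]) z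
    exact sub_eq_zero.mp this
  have e1 := key α₂ α₁ fun z => by have := h z; unfold expAnnihilator at this; linear_combination this
  have e2 := key α₁ α₂ fun z => by have := h z; unfold expAnnihilator at this; linear_combination this
  have : (α₁ - α₂) * u z = 0 := by linear_combination e2 - e1
  exact (mul_eq_zero.mp this).resolve_left (sub_ne_zero.mpr hα)

lemma eq_zero_or_eq_zero_of_mul_eq_zero {g : ℂ → ℂ} (hu : Differentiable ℂ u)
    (hg : Differentiable ℂ g) (h : ∀ z, u z * g z = 0) : (∀ z, u z = 0) ∨ ∀ z, g z = 0 := by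
  have hu' : AnalyticOnNhd ℂ u Set.univ := fun z _ => hu.analyticAt z
  have hg' : AnalyticOnNhd ℂ g Set.univ := fun z _ => hg.analyticAt z
  have := AnalyticOnNhd.eq_zero_or_eq_zero_of_mul_eq_zero hu' hg' (fun z _ => h z)
    isPreconnected_univ
  simpa using this

/-- If `f ^ 3 + w * f ^ 2 * f'` solves `expAnnihilator α₁ α₂ u = 0`, then `f` has no zeros. -/
lemma ne_zero_of_expAnnihilator_eq_zero (hf : Differentiable ℂ f) (h0 : ∃ z, f z ≠ 0)
    (hw : w ≠ 0) (hα : α₁ ≠ α₂)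
    (h : ∀ z, expAnnihilator α₁ α₂ (fun z => f z ^ 3 + w * f z ^ 2 * deriv f z) z = 0) (z : ℂ) :
    f z ≠ 0 := by
  intro hz
  have hf' := hf.deriv
  have hG : Differentiable ℂ (fun z => f z ^ 3 + w * f z ^ 2 * deriv f z) := by fun_prop
  have hG' : deriv (fun z => f z ^ 3 + w * f z ^ 2 * deriv f z) z = 0 := by
    have h1 := (hf z).hasDerivAt
    have h2 := (hf' z).hasDerivAt
    have := (h1.pow 3).add (((h1.pow 2).const_mul w).mul h2)
    refine (this.congr_deriv ?_).deriv
    simp [hz]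
  have hG0 := eq_zero_of_expAnnihilator_eq_zero hG hα h (z₀ := z) (by simp [hz]) hG'
  obtain ⟨z₁, hz₁⟩ := h0
  rcases eq_zero_or_eq_zero_of_mul_eq_zero (u := fun z => f z ^ 2)
    (g := fun z => f z + w * deriv f z) (by fun_prop) (by fun_prop)
    (fun z => by linear_combination hG0 z) with h2 | h2
  · exact hz₁ (pow_eq_zero_iff two_ne_zero |>.mp (h2 z₁))
  · refine hz₁ (eq_zero_of_deriv_eq (α := -w⁻¹) hf (fun z => ?_) hz z₁)
    field_simp
    linear_combination h2 z

/-- A zero-free entire function of exponential type is an exponential. -/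
lemma exists_eq_mul_exp (hf : Differentiable ℂ f) (hne : ∀ z, f z ≠ 0) {D : ℝ}
    (hD0 : 0 ≤ D) (hD : ∀ z, Real.log ‖f z‖ ≤ D * (1 + ‖z‖)) :
    ∃ a, ∀ z, f z = f 0 * Complex.exp (a * z) := by
  have h0 : ∃ z, f z ≠ 0 := ⟨0, hne 0⟩
  obtain ⟨B, hB0, hB⟩ := exists_norm_deriv_le_zeroCount hf h0 hD0 hD
  have hcount : ∀ R, zeroCount f R = 0 := fun R => by
    simp [zeroCount, (zeroMult_eq_zero_iff hf h0 _).mpr (hne _)]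
  have hbd : Bornology.IsBounded (Set.range fun z => deriv f z / f z) := by
    refine (isBounded_iff_forall_norm_le).mpr ⟨B, ?_⟩
    rintro _ ⟨z, rfl⟩
    have := hB (max 1 (2 * ‖z‖)) (le_max_left _ _) z (by linarith [le_max_right 1 (2 * ‖z‖)])
      (fun a ha => absurd ha (hne a))
    rw [hcount, Nat.cast_zero, add_zero] at this
    rw [norm_div]
    exact (div_le_iff₀ (norm_pos_iff.mpr (hne z))).mpr this
  have hq : Differentiable ℂ (fun z => deriv f z / f z) := hf.deriv.div hf hne
  refine ⟨deriv f 0 / f 0, eq_mul_exp_of_deriv_eq hf fun z => ?_⟩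
  rw [← hq.apply_eq_apply_of_bounded hbd z 0, div_mul_cancel₀ _ (hne z)]

/-- Differentiating an exponential relation. -/
lemma exp_relation_sub {x₁ x₂ x₃ x₄ b₁ b₂ b₃ b₄ : ℂ}
    (h : ∀ z, x₁ * Complex.exp (b₁ * z) + x₂ * Complex.exp (b₂ * z) + x₃ * Complex.exp (b₃ * z)
      + x₄ * Complex.exp (b₄ * z) = 0) (b z : ℂ) :
    (b₁ - b) * x₁ * Complex.exp (b₁ * z) + (b₂ - b) * x₂ * Complex.exp (b₂ * z)
      + (b₃ - b) * x₃ * Complex.exp (b₃ * z) + (b₄ - b) * x₄ * Complex.exp (b₄ * z) = 0 := by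
  have hd : ∀ x β : ℂ, HasDerivAt (fun z => x * Complex.exp (β * z))
      (x * (β * Complex.exp (β * z))) z := by
    intro x β
    refine (((hasDerivAt_id z).const_mul β).cexp.const_mul x).congr_deriv ?_
    simp only [id]
    ring
  have h1 := ((((hd x₁ b₁).add (hd x₂ b₂)).add (hd x₃ b₃)).add (hd x₄ b₄)).deriv
  have h2 : ((((fun z => x₁ * Complex.exp (b₁ * z)) + fun z => x₂ * Complex.exp (b₂ * z))
      + fun z => x₃ * Complex.exp (b₃ * z)) + fun z => x₄ * Complex.exp (b₄ * z)) =
      fun _ => (0 : ℂ) := funext h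
  rw [h2, deriv_const] at h1
  linear_combination -h1 - b * h z

/-- In an exponential relation, a coefficient whose exponent differs from all the others
vanishes. -/
lemma exp_relation_coeff_eq_zero {x₁ x₂ x₃ x₄ b₁ b₂ b₃ b₄ : ℂ}
    (h : ∀ z, x₁ * Complex.exp (b₁ * z) + x₂ * Complex.exp (b₂ * z) + x₃ * Complex.exp (b₃ * z)
      + x₄ * Complex.exp (b₄ * z) = 0) (h₂ : b₁ ≠ b₂) (h₃ : b₁ ≠ b₃) (h₄ : b₁ ≠ b₄) : x₁ = 0 := by
  have := exp_relation_sub (exp_relation_sub (exp_relation_sub h b₂) b₃) b₄ 0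
  simpa [sub_eq_zero, h₂, h₃, h₄] using this

lemma iteratedDeriv_mul_exp (C a : ℂ) (k : ℕ) :
    iteratedDeriv k (fun z => C * Complex.exp (a * z)) = fun z => C * a ^ k * Complex.exp (a * z) := by
  induction k with
  | zero => simp
  | succ k ih =>
    rw [iteratedDeriv_succ, ih]
    funext z
    refine ((((hasDerivAt_id z).const_mul a).cexp.const_mul (C * a ^ k)).congr_deriv ?_).deriv
    simp only [id]
    ring

/-- Comparison of coefficients in the equation for an exponential `f`. -/
lemma exponents_of_exp_relation {x y p q a α β : ℂ} (ha : a ≠ 0) (hy : y ≠ 0) (hp : p ≠ 0)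
    (hq : q ≠ 0) (hαβ : α ≠ β)
    (h : ∀ z, x * Complex.exp (3 * a * z) + y * Complex.exp (a * z) =
      p * Complex.exp (α * z) + q * Complex.exp (β * z)) :
    (a = α ∧ 3 * a = β ∧ x = q) ∨ (a = β ∧ 3 * a = α ∧ x = p) := by
  have h3 : a ≠ 3 * a := fun h => ha (by linear_combination -h / 2)
  have key : ∀ α β p q : ℂ, p ≠ 0 → q ≠ 0 → α ≠ β → a = α →
      (∀ z, x * Complex.exp (3 * a * z) + y * Complex.exp (a * z) =
        p * Complex.exp (α * z) + q * Complex.exp (β * z)) → 3 * a = β ∧ x = q := by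
    rintro α β p q - hq hne rfl h
    have hβ : 3 * a = β := by
      by_contra hβ
      refine hq (exp_relation_coeff_eq_zero (x₂ := p) (x₃ := -x) (x₄ := -y) (b₁ := β) (b₂ := a)
        (b₃ := 3 * a) (b₄ := a) (fun z => ?_) hne.symm (Ne.symm hβ) hne.symm)
      linear_combination -h z
    refine ⟨hβ, sub_eq_zero.mp (exp_relation_coeff_eq_zero (x₁ := x - q) (x₂ := y - p) (x₃ := 0)
      (x₄ := 0) (b₁ := 3 * a) (b₂ := a) (b₃ := a) (b₄ := a) (fun z => ?_) h3.symm h3.symm h3.symm)⟩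
    have := h z
    rw [← hβ] at this
    linear_combination this
  by_cases h1 : a = α
  · exact .inl ⟨h1, key α β p q hp hq hαβ h1 h⟩
  by_cases h2 : a = β
  · exact .inr ⟨h2, key β α q p hq hp hαβ.symm h2 fun z => (h z).trans (add_comm _ _)⟩
  · refine absurd (exp_relation_coeff_eq_zero (x₁ := y) (x₂ := x) (x₃ := -p) (x₄ := -q) (b₁ := a)
      (b₂ := 3 * a) (b₃ := α) (b₄ := β) (fun z => ?_) h3 h1 h2) hy
    linear_combination h z

end ExponentialForm

theorem statement2 (n k : ℕ) (hn : n = 3) (c w p₁ p₂ α₁ α₂ : ℂ)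
    (hw : w ≠ 0) (hp₁ : p₁ ≠ 0) (hp₂ : p₂ ≠ 0) (hα₁ : α₁ ≠ 0) (hα₂ : α₂ ≠ 0)
    (hα : α₁ ≠ α₂) (f : ℂ → ℂ) (hf : Differentiable ℂ f)
    (htrans : TranscendentalEntire f) (hord : growthOrderEntire f < ⊤)
    (hN : SmallFn (integZeroCount f) (nevCharEntire f))
    (heq : ∀ z : ℂ, f z ^ n + w * f z ^ (n - 1) * deriv f z + iteratedDeriv k f (z + c)
      = p₁ * Complex.exp (α₁ * z) + p₂ * Complex.exp (α₂ * z)) :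
    ∃ a C : ℂ, a ≠ 0 ∧ C ≠ 0 ∧ (∀ z : ℂ, f z = C * Complex.exp (a * z)) ∧
      1 + a * w ≠ 0 ∧
      ((a = α₁ ∧ (n : ℂ) * a = α₂ ∧ C ^ n * (1 + a * w) = p₂) ∨
       (a = α₂ ∧ (n : ℂ) * a = α₁ ∧ C ^ n * (1 + a * w) = p₁)) := by
  subst hn
  simp only [Nat.add_one_sub_one, Nat.cast_ofNat] at heq ⊢
  have h0 : ∃ z, f z ≠ 0 := by
    by_contra! h
    exact htrans ⟨0, fun z => by simp [h z]⟩
  obtain ⟨D, hD0, hD⟩ := exists_norm_le_exp_linear hf h0 hord hw heq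
  have hne := ne_zero_of_expAnnihilator_eq_zero hf h0 hw hα
    (expAnnihilator_eq_zero hf h0 hD0 hD hp₁ hp₂ hα₁ hα₂ hα heq hN)
  obtain ⟨a, hfa⟩ := exists_eq_mul_exp hf hne hD0 hD
  have ha : a ≠ 0 := by
    rintro rfl
    exact htrans ⟨Polynomial.C (f 0), fun z => by simpa using hfa z⟩
  set C := f 0 with hC
  have hC0 : C ≠ 0 := hne 0
  have hd : ∀ z, deriv f z = C * a * Complex.exp (a * z) := fun z => by
    have := congrFun (iteratedDeriv_mul_exp C a 1) z
    rwa [← funext hfa, iteratedDeriv_one, pow_one] at this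
  have hrel : ∀ z, C ^ 3 * (1 + a * w) * Complex.exp (3 * a * z)
      + C * a ^ k * Complex.exp (a * c) * Complex.exp (a * z)
      = p₁ * Complex.exp (α₁ * z) + p₂ * Complex.exp (α₂ * z) := fun z => by
    have h3 : Complex.exp (3 * a * z) = Complex.exp (a * z) ^ 3 := by
      rw [← Complex.exp_nat_mul]
      congr 1
      push_cast
      ring
    have hk : iteratedDeriv k f (z + c) = C * a ^ k * (Complex.exp (a * z) * Complex.exp (a * c)) := by
      rw [← Complex.exp_add, ← mul_add]
      have := congrFun (iteratedDeriv_mul_exp C a k) (z + c)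
      rwa [← funext hfa] at this
    rw [← heq z, hk, hd z, hfa z, h3]
    ring
  have hcases := exponents_of_exp_relation ha
    (mul_ne_zero (mul_ne_zero hC0 (pow_ne_zero k ha)) (Complex.exp_ne_zero _)) hp₁ hp₂ hα hrel
  refine ⟨a, C, ha, hC0, hfa, fun h => ?_, hcases⟩
  rw [h, mul_zero] at hcases
  rcases hcases with ⟨-, -, h⟩ | ⟨-, -, h⟩
  exacts [hp₂ h.symm, hp₁ h.symm]
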